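/- arXiv:2505.08976 — 4 statements merged into one kernel-verified Lean document; each statement's English description precedes it below -/
import Mathlib

section
/- For every integer n ≥ 3, the closed unit ball B⁴ = {x ∈ ℝ⁴ : ‖x‖ ≤ 1} admits a monohedral tiling by n tiles, each of which is homeomorphic (with its subspace topology) to the product S² × D², where S² = {v ∈ ℝ³ : ‖v‖ = 1} is the unit 2-sphere and D² = {v ∈ ℝ² : ‖v‖ ≤ 1} is the closed unit disk. (This is the 4D Tiling Theorem of the paper in the case where the surface F is a 2-sphere, recorded up to the homeomorphism type of the tiles: each tile is a neighborhood of an embedded 2-sphere and hence homeomorphic to S² × D².) -/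
/-- Two quotient maps out of the same space with the same fibres have homeomorphic targets. -/
theorem Topology.IsQuotientMap.nonempty_homeomorph_of_fibers
    {Z A B : Type*} [TopologicalSpace Z] [TopologicalSpace A] [TopologicalSpace B]
    {p : Z → A} {q : Z → B} (hp : Topology.IsQuotientMap p) (hq : Topology.IsQuotientMap q)
    (h : ∀ x y, p x = p y ↔ q x = q y) : Nonempty (A ≃ₜ B) := by
  let hp' := Topology.IsQuotientMap.homeomorph (f := ⟨p, hp.continuous⟩) hp
  let hq' := Topology.IsQuotientMap.homeomorph (f := ⟨q, hq.continuous⟩) hq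
  exact ⟨(hp'.symm.trans (Homeomorph.Quotient.congrRight h)).trans hq'⟩

/-- A compact fibrewise strictly star-shaped sublevel set in `Y × E` is homeomorphic to the
product of `Y` with the closed unit ball of `E`. -/
theorem nonempty_homeomorph_prod_closedBall_of_strictly_starShaped
    {Y E : Type*} [TopologicalSpace Y] [CompactSpace Y] [T2Space Y]
    [NormedAddCommGroup E] [NormedSpace ℝ E] [ProperSpace E] [Nontrivial E]
    {f : Y × E → ℝ} (hf : Continuous f) {M : ℝ}
    (h0 : ∀ y, f (y, 0) < 0) (hM : ∀ y v, f (y, v) ≤ 0 → ‖v‖ ≤ M)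
    (hstar : ∀ y v, f (y, v) ≤ 0 → ∀ c : ℝ, 0 ≤ c → c < 1 → f (y, c • v) < 0) :
    Nonempty ({p : Y × E | f p ≤ 0} ≃ₜ Y × Metric.closedBall (0 : E) 1) := by
  classical
  have hcompact : CompactSpace (Metric.sphere (0 : E) 1) :=
    isCompact_iff_compactSpace.1 (isCompact_sphere 0 1)
  let Z := {z : Y × Metric.sphere (0 : E) 1 × Set.Icc (0 : ℝ) M |
    f (z.1, (z.2.2 : ℝ) • (z.2.1 : E)) = 0}
  have hZ : IsClosed Z := isClosed_eq (by fun_prop) continuous_const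
  have hZc : CompactSpace Z := isCompact_iff_compactSpace.1 hZ.isCompact
  have nrm (α : Metric.sphere (0 : E) 1) : ‖(α : E)‖ = 1 := by simp
  have zpos (z : Z) : 0 < (z.1.2.2 : ℝ) := by
    refine lt_of_le_of_ne z.1.2.2.2.1 fun h => ?_
    have hz : f (z.1.1, (z.1.2.2 : ℝ) • (z.1.2.1 : E)) = 0 := z.2
    rw [← h, zero_smul] at hz
    exact (h0 _).ne hz
  have hle (y : Y) (v : E) (hv : f (y, v) ≤ 0) (c : ℝ) (hc : 0 ≤ c) (hc1 : c ≤ 1) :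
      f (y, c • v) ≤ 0 := by
    rcases hc1.lt_or_eq with h | rfl
    · exact (hstar y v hv c hc h).le
    · simpa using hv
  -- a vector inside the sublevel set is no longer than the boundary vector in its direction
  have key (y : Y) (α : E) (h s : ℝ) (hh : 0 < h) (hz : f (y, h • α) = 0)
      (hs : f (y, s • α) ≤ 0) : s ≤ h := by
    by_contra! hlt
    have hs0 : 0 < s := hh.trans hlt
    have := hstar y (s • α) hs (h / s) (by positivity) ((div_lt_one hs0).2 hlt)
    rw [smul_smul, div_mul_cancel₀ _ hs0.ne', hz] at this
    exact lt_irrefl _ this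
  have exZ (y : Y) (α : Metric.sphere (0 : E) 1) : ∃ z : Z, z.1.1 = y ∧ z.1.2.1 = α := by
    have hM0 : 0 ≤ M := by simpa using hM y 0 (h0 y).le
    have h1 : 0 ≤ f (y, (M + 1) • (α : E)) := by
      by_contra! hneg
      have := hM _ _ hneg.le
      rw [norm_smul, nrm, mul_one, Real.norm_eq_abs, abs_of_nonneg (by linarith)] at this
      linarith
    obtain ⟨h, hh, hz⟩ := intermediate_value_Icc (f := fun h : ℝ => f (y, h • (α : E)))
      (show (0 : ℝ) ≤ M + 1 by linarith) (by fun_prop)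
      (show (0 : ℝ) ∈ _ from ⟨by simpa using (h0 y).le, h1⟩)
    have hhM : h ≤ M := by
      have := hM _ _ (le_of_eq hz)
      rwa [norm_smul, nrm, mul_one, Real.norm_eq_abs, abs_of_nonneg hh.1] at this
    exact ⟨⟨(y, α, ⟨h, hh.1, hhM⟩), hz⟩, rfl, rfl⟩
  let p : Z × Set.Icc (0 : ℝ) 1 → {p : Y × E | f p ≤ 0} := fun w =>
    ⟨(w.1.1.1, (w.2 : ℝ) • (w.1.1.2.2 : ℝ) • (w.1.1.2.1 : E)),
      hle _ _ (le_of_eq w.1.2) _ w.2.2.1 w.2.2.2⟩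
  let q : Z × Set.Icc (0 : ℝ) 1 → Y × Metric.closedBall (0 : E) 1 := fun w =>
    (w.1.1.1, ⟨(w.2 : ℝ) • (w.1.1.2.1 : E), by
      rw [mem_closedBall_zero_iff, norm_smul, nrm, mul_one, Real.norm_eq_abs,
        abs_of_nonneg w.2.2.1]
      exact w.2.2.2⟩)
  have hpc : Continuous p := by fun_prop
  have hqc : Continuous q := by fun_prop
  obtain ⟨α₀, hα₀⟩ : ∃ α : E, ‖α‖ = 1 := exists_norm_eq E zero_le_one
  have dir (v : E) : ∃ α : Metric.sphere (0 : E) 1, v = ‖v‖ • (α : E) := by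
    by_cases hv : v = 0
    · exact ⟨⟨α₀, by simpa using hα₀⟩, by simp [hv]⟩
    · refine ⟨⟨‖v‖⁻¹ • v, by simp [norm_smul, hv]⟩, ?_⟩
      simp [smul_smul, hv]
  have hps : Function.Surjective p := by
    rintro ⟨⟨y, v⟩, hv⟩
    obtain ⟨α, hα⟩ := dir v
    obtain ⟨z, rfl, rfl⟩ := exZ y α
    have hz := zpos z
    have hvs : ‖v‖ ≤ z.1.2.2 := key _ _ _ _ hz z.2 (by rw [← hα]; exact hv)
    refine ⟨(z, ⟨‖v‖ / z.1.2.2, by positivity, (div_le_one hz).2 hvs⟩), ?_⟩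
    apply Subtype.ext
    refine Prod.ext rfl ?_
    change (‖v‖ / (z.1.2.2 : ℝ)) • (z.1.2.2 : ℝ) • (z.1.2.1 : E) = v
    rw [smul_smul, div_mul_cancel₀ _ hz.ne', ← hα]
  have hqs : Function.Surjective q := by
    rintro ⟨y, v, hv⟩
    obtain ⟨α, hα⟩ := dir v
    obtain ⟨z, rfl, rfl⟩ := exZ y α
    exact ⟨(z, ⟨‖v‖, norm_nonneg _, by simpa using hv⟩), Prod.ext rfl (Subtype.ext hα.symm)⟩
  have hunit (α β : Metric.sphere (0 : E) 1) (a b : ℝ) (ha : 0 < a) (hb : 0 ≤ b)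
      (h : a • (α : E) = b • (β : E)) : a = b ∧ α = β := by
    have hab : a = b := by
      have := congrArg norm h
      rwa [norm_smul, norm_smul, nrm, nrm, mul_one, mul_one, Real.norm_eq_abs, Real.norm_eq_abs,
        abs_of_pos ha, abs_of_nonneg hb] at this
    subst hab
    exact ⟨rfl, Subtype.ext (smul_right_injective E ha.ne' h)⟩
  have huniq (z w : Z) (h1 : z.1.1 = w.1.1) (h2 : z.1.2.1 = w.1.2.1) : z = w := by
    have hz : f (z.1.1, (z.1.2.2 : ℝ) • (z.1.2.1 : E)) = 0 := z.2
    have hw : f (w.1.1, (w.1.2.2 : ℝ) • (w.1.2.1 : E)) = 0 := w.2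
    rw [← h1, ← h2] at hw
    exact Subtype.ext (Prod.ext h1 (Prod.ext h2 (Subtype.ext
      (le_antisymm (key _ _ _ _ (zpos w) hw hz.le) (key _ _ _ _ (zpos z) hz hw.le)))))
  have hzero (z w : Z) (a b : Set.Icc (0 : ℝ) 1) (ha : (a : ℝ) = 0) (h1 : z.1.1 = w.1.1) :
      (p (z, a) = p (w, b) ↔ (b : ℝ) = 0) ∧ (q (z, a) = q (w, b) ↔ (b : ℝ) = 0) := by
    have hα : ((w.1.2.1 : E)) ≠ 0 := by
      intro h; have := nrm w.1.2.1; simp [h] at this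
    constructor
    · rw [Subtype.ext_iff, Prod.ext_iff]
      simp only [p, h1, ha, true_and, zero_smul]
      rw [eq_comm, smul_eq_zero_iff_left (smul_ne_zero (zpos w).ne' hα)]
    · rw [Prod.ext_iff, Subtype.ext_iff]
      simp only [q, h1, ha, true_and, zero_smul]
      rw [eq_comm, smul_eq_zero_iff_left hα]
  refine (hpc.isClosedMap.isQuotientMap hpc hps).nonempty_homeomorph_of_fibers
    (hqc.isClosedMap.isQuotientMap hqc hqs) ?_
  rintro ⟨z, a⟩ ⟨w, b⟩
  by_cases h1 : z.1.1 = w.1.1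
  · by_cases ha : (a : ℝ) = 0
    · rw [(hzero z w a b ha h1).1, (hzero z w a b ha h1).2]
    · have ha' : 0 < (a : ℝ) := lt_of_le_of_ne a.2.1 (Ne.symm ha)
      constructor
      · intro h
        have h2 : (a : ℝ) • (z.1.2.2 : ℝ) • (z.1.2.1 : E) = (b : ℝ) • (w.1.2.2 : ℝ) • (w.1.2.1 : E) :=
          congrArg (fun x => x.1.2) h
        rw [smul_smul, smul_smul] at h2
        obtain ⟨h3, h4⟩ := hunit _ _ _ _ (mul_pos ha' (zpos z)) (mul_nonneg b.2.1 (zpos w).le) h2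
        obtain rfl := huniq z w h1 h4
        rw [show a = b from Subtype.ext (mul_right_cancel₀ (zpos z).ne' h3)]
      · intro h
        have h2 : (a : ℝ) • (z.1.2.1 : E) = (b : ℝ) • (w.1.2.1 : E) :=
          congrArg (fun x => (x.2 : E)) h
        obtain ⟨h3, h4⟩ := hunit _ _ _ _ ha' b.2.1 h2
        obtain rfl := huniq z w h1 h4
        rw [show a = b from Subtype.ext h3]
  · exact ⟨fun h => (h1 (congrArg (fun x => x.1.1) h)).elim,
      fun h => (h1 (congrArg (fun x => x.1) h)).elim⟩

/-- The quadratic form of the squared norm in the oblique coordinates is fibrewise convex. -/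
theorem obliqueForm_convex_comb_lt_one {κ : ℝ} (hκ : |κ| ≤ 2) {s t c d s' t' c' d' r : ℝ}
    (hr0 : 0 ≤ r) (hr1 : r < 1)
    (h : s ^ 2 + κ * s * t + t ^ 2 + c ^ 2 + d ^ 2 ≤ 1)
    (h' : s' ^ 2 + κ * s' * t' + t' ^ 2 + c' ^ 2 + d' ^ 2 < 1) :
    (r * s + (1 - r) * s') ^ 2 + κ * (r * s + (1 - r) * s') * (r * t + (1 - r) * t')
      + (r * t + (1 - r) * t') ^ 2 + (r * c + (1 - r) * c') ^ 2 + (r * d + (1 - r) * d') ^ 2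
      < 1 := by
  obtain ⟨hκ1, hκ2⟩ := abs_le.1 hκ
  have hconv : 0 ≤ (s - s') ^ 2 + κ * (s - s') * (t - t') + (t - t') ^ 2
      + (c - c') ^ 2 + (d - d') ^ 2 := by
    nlinarith [mul_nonneg (by linarith : 0 ≤ 2 + κ) (sq_nonneg ((s - s') + (t - t'))),
      mul_nonneg (by linarith : 0 ≤ 2 - κ) (sq_nonneg ((s - s') - (t - t'))),
      sq_nonneg (c - c'), sq_nonneg (d - d')]
  nlinarith [mul_nonneg (mul_nonneg hr0 (by linarith : 0 ≤ 1 - r)) hconv,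
    mul_le_mul_of_nonneg_left h hr0, mul_lt_mul_of_pos_left h' (by linarith : 0 < 1 - r)]

/-- Defining function of the tile. -/
noncomputable def tileFun (κ s t c d ρ : ℝ) : ℝ :=
  max (max (s ^ 2 + κ * |s| * t + t ^ 2 + c ^ 2 + d ^ 2 - 1) (-t))
    (max (1 / 16 - ρ) (min (-s) ((t - 1 / 4) ^ 2 + c ^ 2 + d ^ 2 - 1 / 256)))

theorem tileFun_nonpos_iff {κ s t c d ρ : ℝ} : tileFun κ s t c d ρ ≤ 0 ↔
    s ^ 2 + κ * |s| * t + t ^ 2 + c ^ 2 + d ^ 2 ≤ 1 ∧ 0 ≤ t ∧ 1 / 16 ≤ ρ ∧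
      (0 ≤ s ∨ (t - 1 / 4) ^ 2 + c ^ 2 + d ^ 2 ≤ 1 / 256) := by
  simp [tileFun, and_assoc]

theorem tileFun_neg_iff {κ s t c d ρ : ℝ} : tileFun κ s t c d ρ < 0 ↔
    s ^ 2 + κ * |s| * t + t ^ 2 + c ^ 2 + d ^ 2 < 1 ∧ 0 < t ∧ 1 / 16 < ρ ∧
      (0 < s ∨ (t - 1 / 4) ^ 2 + c ^ 2 + d ^ 2 < 1 / 256) := by
  simp [tileFun, and_assoc]

theorem center_bounds {a b e : ℝ} (h : a ^ 2 + b ^ 2 + e ^ 2 = 1) :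
    -1 ≤ a ∧ a ≤ 1 := abs_le.1 (abs_le_one_iff_mul_self_le_one.2 (by nlinarith))

theorem obliqueForm_center_lt_one {κ a b e : ℝ} (hκ : |κ| ≤ 2) (h : a ^ 2 + b ^ 2 + e ^ 2 = 1) :
    (1 / 4 + 3 / 16 * a) ^ 2 + κ * (1 / 4 + 3 / 16 * a) * (1 / 4) + (1 / 4) ^ 2
      + (3 / 16 * b) ^ 2 + (3 / 16 * e) ^ 2 < 1 := by
  obtain ⟨hκ1, hκ2⟩ := abs_le.1 hκ
  obtain ⟨ha, ha'⟩ := center_bounds h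
  nlinarith [mul_nonneg (by linarith : 0 ≤ 2 - κ) (by linarith : 0 ≤ 1 / 4 + 3 / 16 * a)]

theorem obliqueForm_neg_center_lt_one {κ a b e : ℝ} (hκ : |κ| ≤ 2)
    (h : a ^ 2 + b ^ 2 + e ^ 2 = 1) :
    (-(1 / 4 + 3 / 16 * a)) ^ 2 + κ * -(1 / 4 + 3 / 16 * a) * (1 / 4) + (1 / 4) ^ 2
      + (3 / 16 * b) ^ 2 + (3 / 16 * e) ^ 2 < 1 := by
  have := obliqueForm_center_lt_one (κ := -κ) (by rwa [abs_neg]) h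
  linarith

theorem tileFun_center_neg {κ a b e : ℝ} (hκ : |κ| ≤ 2) (h : a ^ 2 + b ^ 2 + e ^ 2 = 1) :
    tileFun κ (1 / 4 + 3 / 16 * a) (1 / 4) (3 / 16 * b) (3 / 16 * e) (3 / 16) < 0 := by
  obtain ⟨ha, ha'⟩ := center_bounds h
  have hs : 0 < 1 / 4 + 3 / 16 * a := by linarith
  rw [tileFun_neg_iff, abs_of_pos hs]
  exact ⟨obliqueForm_center_lt_one hκ h, by norm_num, by norm_num, Or.inl hs⟩

theorem obliqueForm_lt_one_of_small {κ s t c d : ℝ} (hκ : |κ| ≤ 2) (hs : 0 ≤ s)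
    (hs' : s ≤ 7 / 16) (ht : 0 ≤ t) (h : (t - 1 / 4) ^ 2 + c ^ 2 + d ^ 2 < 1 / 256) :
    s ^ 2 + κ * s * t + t ^ 2 + c ^ 2 + d ^ 2 < 1 := by
  have ht' : t ≤ 5 / 16 := by
    have : |t - 1 / 4| ≤ 1 / 16 :=
      abs_le_of_sq_le_sq (by linarith [sq_nonneg c, sq_nonneg d]) (by norm_num)
    linarith [le_of_abs_le this]
  have h1 := mul_le_mul_of_nonneg_right (le_of_abs_le hκ) (mul_nonneg hs ht)
  have h2 := pow_le_pow_left₀ hs hs' 2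
  have h3 := pow_le_pow_left₀ ht ht' 2
  have h4 := mul_le_mul hs' ht' ht (by norm_num)
  linarith [sq_nonneg (t - 1 / 4)]

theorem tileFun_starShaped {κ a b e p q r : ℝ} (hκ : |κ| ≤ 2) (h : a ^ 2 + b ^ 2 + e ^ 2 = 1)
    (hr0 : 0 ≤ r) (hr1 : r < 1)
    (hT : tileFun κ (1 / 4 + (3 / 16 + p) * a) (1 / 4 + q) ((3 / 16 + p) * b) ((3 / 16 + p) * e)
      (3 / 16 + p) ≤ 0) :
    tileFun κ (1 / 4 + (3 / 16 + r * p) * a) (1 / 4 + r * q) ((3 / 16 + r * p) * b)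
      ((3 / 16 + r * p) * e) (3 / 16 + r * p) < 0 := by
  obtain ⟨ha, ha'⟩ := center_bounds h
  obtain ⟨hN, ht, hρ, hsp⟩ := tileFun_nonpos_iff.1 hT
  have hr1' : 0 < 1 - r := by linarith
  have hcenter := obliqueForm_center_lt_one hκ h
  have es : 1 / 4 + (3 / 16 + r * p) * a
      = r * (1 / 4 + (3 / 16 + p) * a) + (1 - r) * (1 / 4 + 3 / 16 * a) := by ring
  have et : 1 / 4 + r * q = r * (1 / 4 + q) + (1 - r) * (1 / 4) := by ring
  have ec : (3 / 16 + r * p) * b = r * ((3 / 16 + p) * b) + (1 - r) * (3 / 16 * b) := by ring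
  have ee : (3 / 16 + r * p) * e = r * ((3 / 16 + p) * e) + (1 - r) * (3 / 16 * e) := by ring
  rw [tileFun_neg_iff]
  have ht' : 0 < 1 / 4 + r * q := by
    rw [et]
    exact add_pos_of_nonneg_of_pos (mul_nonneg hr0 ht) (mul_pos hr1' (by norm_num))
  have hρ' : 1 / 16 < 3 / 16 + r * p := by
    linarith [mul_nonneg hr0 (sub_nonneg.2 hρ)]
  by_cases hs : 0 ≤ 1 / 4 + (3 / 16 + p) * a
  · have hs' : 0 < 1 / 4 + (3 / 16 + r * p) * a := by
      rw [es]
      exact add_pos_of_nonneg_of_pos (mul_nonneg hr0 hs) (mul_pos hr1' (by linarith))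
    refine ⟨?_, ht', hρ', Or.inl hs'⟩
    rw [abs_of_nonneg hs] at hN
    rw [abs_of_pos hs', es, et, ec, ee]
    exact obliqueForm_convex_comb_lt_one hκ hr0 hr1 hN hcenter
  · push Not at hs
    have hplug := hsp.resolve_left (not_le.2 hs)
    -- the plug is far from the centre of the tunnel
    have hp : 1 / 16 < p := by
      linarith [mul_nonneg (by linarith : 0 ≤ 3 / 16 + p) (by linarith : 0 ≤ 1 + a)]
    have hrp : 0 ≤ (1 - r) * (p - 1 / 16) := mul_nonneg hr1'.le (by linarith)
    have hbe : 0 ≤ b ^ 2 + e ^ 2 := by positivity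
    have hshrink : (3 / 16 + r * p) ^ 2 ≤ (1 - (1 - r) / 4) ^ 2 * (3 / 16 + p) ^ 2 := by
      rw [← mul_pow]
      exact pow_le_pow_left₀ (by linarith) (by linarith) 2
    have hplug' : (1 / 4 + r * q - 1 / 4) ^ 2 + ((3 / 16 + r * p) * b) ^ 2
        + ((3 / 16 + r * p) * e) ^ 2 < 1 / 256 := by
      have h1 : r ^ 2 ≤ (1 - (1 - r) / 4) ^ 2 := pow_le_pow_left₀ hr0 (by linarith) 2
      have h2 : (1 - (1 - r) / 4) ^ 2 < 1 := pow_lt_one₀ (by linarith) (by linarith) two_ne_zero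
      have h3 := mul_le_mul_of_nonneg_right hshrink hbe
      have h4 := mul_le_mul_of_nonneg_right h1 (sq_nonneg q)
      have h5 := mul_le_mul_of_nonneg_left hplug (sq_nonneg (1 - (1 - r) / 4))
      linarith
    refine ⟨?_, ht', hρ', Or.inr hplug'⟩
    by_cases hs' : 0 ≤ 1 / 4 + (3 / 16 + r * p) * a
    · have hsle : 1 / 4 + (3 / 16 + r * p) * a ≤ 7 / 16 := by
        linarith [mul_nonneg hr0 (by linarith : 0 ≤ -(1 / 4 + (3 / 16 + p) * a)),
          mul_nonneg hr1'.le (by linarith : 0 ≤ 1 - a)]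
      rw [abs_of_nonneg hs']
      exact obliqueForm_lt_one_of_small hκ hs' hsle ht'.le hplug'
    · push Not at hs'
      rw [abs_of_neg hs] at hN
      rw [abs_of_neg hs']
      rw [← neg_sq, es, et, ec, ee,
        show ∀ x y : ℝ, -(r * x + (1 - r) * y) = r * -x + (1 - r) * -y by intros; ring]
      rw [← neg_sq] at hN
      exact obliqueForm_convex_comb_lt_one hκ hr0 hr1 hN (obliqueForm_neg_center_lt_one hκ h)

theorem bound_of_tileFun_nonpos {κ a b e p q : ℝ} (hκ : -1 ≤ κ) (h : a ^ 2 + b ^ 2 + e ^ 2 = 1)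
    (hT : tileFun κ (1 / 4 + (3 / 16 + p) * a) (1 / 4 + q) ((3 / 16 + p) * b) ((3 / 16 + p) * e)
      (3 / 16 + p) ≤ 0) : p ^ 2 + q ^ 2 ≤ 100 := by
  obtain ⟨hN, ht, hρ, -⟩ := tileFun_nonpos_iff.1 hT
  have h1 := mul_nonneg (abs_nonneg (1 / 4 + (3 / 16 + p) * a)) ht
  have h2 := sq_abs (1 / 4 + (3 / 16 + p) * a)
  have h3 := sq_nonneg (|1 / 4 + (3 / 16 + p) * a| - (1 / 4 + q))
  have h4 : (1 / 4 + (3 / 16 + p) * a) ^ 2 + (1 / 4 + q) ^ 2 + ((3 / 16 + p) * b) ^ 2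
      + ((3 / 16 + p) * e) ^ 2 ≤ 2 := by
    nlinarith [mul_nonneg (by linarith : 0 ≤ κ + 1) h1, sq_nonneg ((3 / 16 + p) * b), sq_nonneg ((3 / 16 + p) * e)]
  have h5 : (3 / 16 + p) ^ 2 = ((3 / 16 + p) * a) ^ 2 + ((3 / 16 + p) * b) ^ 2
      + ((3 / 16 + p) * e) ^ 2 := by
    linear_combination (-(3 / 16 + p) ^ 2) * h
  nlinarith [sq_nonneg ((3 / 16 + p) * a + 1 / 2), sq_nonneg (q + 1 / 2), sq_nonneg (p + 3 / 8)]

/-- Rotation by the angle `θ` in the plane of the first two coordinates of `ℝ⁴`. -/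
noncomputable def planeRotationFun (θ : ℝ) (x : EuclideanSpace ℝ (Fin 4)) :
    EuclideanSpace ℝ (Fin 4) :=
  !₂[x 0 * Real.cos θ - x 1 * Real.sin θ, x 0 * Real.sin θ + x 1 * Real.cos θ, x 2, x 3]

theorem planeRotationFun_planeRotationFun (θ η : ℝ) (x : EuclideanSpace ℝ (Fin 4)) :
    planeRotationFun θ (planeRotationFun η x) = planeRotationFun (θ + η) x := by
  ext i
  fin_cases i <;> simp [planeRotationFun, Real.cos_add, Real.sin_add] <;> ring

theorem planeRotationFun_zero (x : EuclideanSpace ℝ (Fin 4)) : planeRotationFun 0 x = x := by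
  ext i
  fin_cases i <;> simp [planeRotationFun]

theorem isometry_planeRotationFun (θ : ℝ) : Isometry (planeRotationFun θ) := by
  refine Isometry.of_dist_eq fun x y => ?_
  rw [EuclideanSpace.dist_eq, EuclideanSpace.dist_eq]
  congr 1
  simp only [Fin.sum_univ_four, Real.dist_eq, sq_abs, planeRotationFun]
  simp
  linear_combination ((x 0 - y 0) ^ 2 + (x 1 - y 1) ^ 2) * Real.sin_sq_add_cos_sq θ

/-- Rotation by the angle `θ` in the plane of the first two coordinates, as an isometry. -/
noncomputable def planeRotation (θ : ℝ) :
    EuclideanSpace ℝ (Fin 4) ≃ᵢ EuclideanSpace ℝ (Fin 4) where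
  toFun := planeRotationFun θ
  invFun := planeRotationFun (-θ)
  left_inv x := by rw [planeRotationFun_planeRotationFun, neg_add_cancel, planeRotationFun_zero]
  right_inv x := by rw [planeRotationFun_planeRotationFun, add_neg_cancel, planeRotationFun_zero]
  isometry_toFun := isometry_planeRotationFun θ

theorem planeRotation_apply (θ : ℝ) (x : EuclideanSpace ℝ (Fin 4)) :
    planeRotation θ x = !₂[x 0 * Real.cos θ - x 1 * Real.sin θ,
      x 0 * Real.sin θ + x 1 * Real.cos θ, x 2, x 3] := rfl

theorem planeRotation_planeRotation (θ η : ℝ) (x : EuclideanSpace ℝ (Fin 4)) :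
    planeRotation θ (planeRotation η x) = planeRotation (θ + η) x :=
  planeRotationFun_planeRotationFun θ η x

theorem planeRotation_symm (θ : ℝ) : (planeRotation θ).symm = planeRotation (-θ) :=
  IsometryEquiv.ext fun _ => rfl

theorem planeRotation_add_int_mul_two_pi (θ : ℝ) (m : ℤ) (x : EuclideanSpace ℝ (Fin 4)) :
    planeRotation (θ + m * (2 * Real.pi)) x = planeRotation θ x := by
  simp [planeRotation_apply, Real.cos_add_int_mul_two_pi, Real.sin_add_int_mul_two_pi]

theorem mem_planeRotation_image {θ : ℝ} {s : Set (EuclideanSpace ℝ (Fin 4))}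
    {x : EuclideanSpace ℝ (Fin 4)} : x ∈ planeRotation θ '' s ↔ planeRotation (-θ) x ∈ s := by
  rw [← IsometryEquiv.preimage_symm, planeRotation_symm, Set.mem_preimage]

theorem norm_planeRotation (θ : ℝ) (x : EuclideanSpace ℝ (Fin 4)) :
    ‖planeRotation θ x‖ = ‖x‖ := by
  have h0 : planeRotation θ 0 = 0 := by
    ext i
    fin_cases i <;> simp [planeRotation_apply]
  rw [← dist_zero_right, ← dist_zero_right, ← (planeRotation θ).dist_eq x 0, h0]

/-- The part of the closed unit ball lying over the sector `0 ≤ θ ≤ φ` of the first two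
coordinates. -/
def ballWedge (φ : ℝ) : Set (EuclideanSpace ℝ (Fin 4)) :=
  {x | 0 ≤ x 1 ∧ 0 ≤ x 0 * Real.sin φ - x 1 * Real.cos φ ∧ ‖x‖ ≤ 1}

/-- The squared distance to the axis of the tunnel, in oblique coordinates. -/
noncomputable def tunnelDistSq (φ : ℝ) (x : EuclideanSpace ℝ (Fin 4)) : ℝ :=
  ((x 0 * Real.sin φ - x 1 * Real.cos φ) / Real.sin φ - 1 / 4) ^ 2 + x 2 ^ 2 + x 3 ^ 2

/-- The wedge with a tunnel drilled out of it, and the rotated core of the tunnel glued on. -/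
noncomputable def drilledWedge (φ : ℝ) : Set (EuclideanSpace ℝ (Fin 4)) :=
  (ballWedge φ ∩ {x | 1 / 256 ≤ tunnelDistSq φ x}) ∪
    planeRotation φ '' (ballWedge φ ∩ {x | tunnelDistSq φ x ≤ 1 / 256})

/-- The point of `ℝ⁴` with oblique coordinates `(s, t, c, d)`, where `s` and `t` are measured
along the two sides of the sector of angle `φ`. -/
noncomputable def obliquePoint (φ s t c d : ℝ) : EuclideanSpace ℝ (Fin 4) :=
  !₂[s + t * Real.cos φ, t * Real.sin φ, c, d]

theorem norm_obliquePoint_le_one_iff {φ s t c d : ℝ} : ‖obliquePoint φ s t c d‖ ≤ 1 ↔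
    s ^ 2 + 2 * Real.cos φ * s * t + t ^ 2 + c ^ 2 + d ^ 2 ≤ 1 := by
  rw [← sq_le_one_iff₀ (norm_nonneg _), EuclideanSpace.real_norm_sq_eq]
  simp only [Fin.sum_univ_four, obliquePoint]
  simp
  rw [← sub_nonneg, ← sub_nonneg (a := (1 : ℝ))]
  refine iff_of_eq (congrArg _ ?_)
  linear_combination (-t ^ 2) * Real.sin_sq_add_cos_sq φ

theorem obliquePoint_mem_ballWedge_iff {φ s t c d : ℝ} (hφ : 0 < Real.sin φ) :
    obliquePoint φ s t c d ∈ ballWedge φ ↔ 0 ≤ t ∧ 0 ≤ s ∧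
      s ^ 2 + 2 * Real.cos φ * s * t + t ^ 2 + c ^ 2 + d ^ 2 ≤ 1 := by
  rw [ballWedge, Set.mem_ofPred_eq, norm_obliquePoint_le_one_iff]
  have h : (s + t * Real.cos φ) * Real.sin φ - t * Real.sin φ * Real.cos φ = s * Real.sin φ := by
    ring
  simp [obliquePoint, h, hφ]

theorem tunnelDistSq_obliquePoint {φ s t c d : ℝ} (hφ : 0 < Real.sin φ) :
    tunnelDistSq φ (obliquePoint φ s t c d) = (s - 1 / 4) ^ 2 + c ^ 2 + d ^ 2 := by
  have h : (s + t * Real.cos φ) * Real.sin φ - t * Real.sin φ * Real.cos φ = s * Real.sin φ := by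
    ring
  simp [tunnelDistSq, obliquePoint, h, hφ.ne']

theorem exists_eq_obliquePoint {φ : ℝ} (hφ : 0 < Real.sin φ) (x : EuclideanSpace ℝ (Fin 4)) :
    ∃ s t c d, x = obliquePoint φ s t c d := by
  refine ⟨x 0 - x 1 / Real.sin φ * Real.cos φ, x 1 / Real.sin φ, x 2, x 3, ?_⟩
  ext i
  fin_cases i <;> simp [obliquePoint, hφ.ne']

theorem planeRotation_obliquePoint (φ s t c d : ℝ) :
    planeRotation φ (obliquePoint φ s t c d)
      = obliquePoint φ (-t) (s + 2 * Real.cos φ * t) c d := by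
  have h := Real.sin_sq_add_cos_sq φ
  ext i
  fin_cases i <;> simp [obliquePoint, planeRotation_apply]
  · linear_combination (-t) * h
  · ring

theorem obliquePoint_injective {φ s t c d s' t' c' d' : ℝ} (hφ : 0 < Real.sin φ)
    (h : obliquePoint φ s t c d = obliquePoint φ s' t' c' d') :
    s = s' ∧ t = t' ∧ c = c' ∧ d = d' := by
  have h0 : s + t * Real.cos φ = s' + t' * Real.cos φ := congrArg (fun x => x 0) h
  have h1 : t * Real.sin φ = t' * Real.sin φ := congrArg (fun x => x 1) h
  obtain rfl := mul_right_cancel₀ hφ.ne' h1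
  exact ⟨add_right_cancel h0, rfl, congrArg (fun x => x 2) h, congrArg (fun x => x 3) h⟩

theorem sphere_three_sq_sum (u : Metric.sphere (0 : EuclideanSpace ℝ (Fin 3)) 1) :
    (u : EuclideanSpace ℝ (Fin 3)) 0 ^ 2 + (u : EuclideanSpace ℝ (Fin 3)) 1 ^ 2
      + (u : EuclideanSpace ℝ (Fin 3)) 2 ^ 2 = 1 := by
  have h : ‖(u : EuclideanSpace ℝ (Fin 3))‖ = 1 := by simp
  rw [← Fin.sum_univ_three (fun i => (u : EuclideanSpace ℝ (Fin 3)) i ^ 2),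
    ← EuclideanSpace.real_norm_sq_eq, h, one_pow]

theorem exists_spherical_coordinates {a b e : ℝ} (h : 1 / 256 ≤ a ^ 2 + b ^ 2 + e ^ 2) :
    ∃ (u : Metric.sphere (0 : EuclideanSpace ℝ (Fin 3)) 1) (ρ : ℝ), 1 / 16 ≤ ρ ∧
      ρ * (u : EuclideanSpace ℝ (Fin 3)) 0 = a ∧ ρ * (u : EuclideanSpace ℝ (Fin 3)) 1 = b ∧
      ρ * (u : EuclideanSpace ℝ (Fin 3)) 2 = e := by
  have hx : ‖(!₂[a, b, e] : EuclideanSpace ℝ (Fin 3))‖ ^ 2 = a ^ 2 + b ^ 2 + e ^ 2 := by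
    rw [EuclideanSpace.real_norm_sq_eq]
    simp [Fin.sum_univ_three]
  have hle : 1 / 16 ≤ ‖(!₂[a, b, e] : EuclideanSpace ℝ (Fin 3))‖ :=
    le_of_abs_le (abs_le_of_sq_le_sq (by rw [hx]; norm_num at h ⊢; exact h) (norm_nonneg _))
  have hpos : ‖(!₂[a, b, e] : EuclideanSpace ℝ (Fin 3))‖ ≠ 0 := by linarith
  refine ⟨⟨‖(!₂[a, b, e] : EuclideanSpace ℝ (Fin 3))‖⁻¹ • !₂[a, b, e], ?_⟩, _, hle, ?_, ?_, ?_⟩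
  · rw [mem_sphere_zero_iff_norm, norm_smul, norm_inv, norm_norm, inv_mul_cancel₀ hpos]
  all_goals
    simp only [PiLp.smul_apply, smul_eq_mul]
    rw [mul_inv_cancel_left₀ hpos]
    rfl

/-- Defining function of the tile in coordinates around the core sphere. -/
noncomputable def coordTileFun (κ : ℝ)
    (p : Metric.sphere (0 : EuclideanSpace ℝ (Fin 3)) 1 × EuclideanSpace ℝ (Fin 2)) : ℝ :=
  tileFun κ (1 / 4 + (3 / 16 + p.2 0) * (p.1 : EuclideanSpace ℝ (Fin 3)) 0) (1 / 4 + p.2 1)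
    ((3 / 16 + p.2 0) * (p.1 : EuclideanSpace ℝ (Fin 3)) 1)
    ((3 / 16 + p.2 0) * (p.1 : EuclideanSpace ℝ (Fin 3)) 2) (3 / 16 + p.2 0)

/-- The parametrization of a neighbourhood of the core sphere of the tile. -/
noncomputable def tileParam (φ : ℝ)
    (p : Metric.sphere (0 : EuclideanSpace ℝ (Fin 3)) 1 × EuclideanSpace ℝ (Fin 2)) :
    EuclideanSpace ℝ (Fin 4) :=
  obliquePoint φ (1 / 4 + (3 / 16 + p.2 0) * (p.1 : EuclideanSpace ℝ (Fin 3)) 0)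
    (1 / 4 + p.2 1 - 2 * Real.cos φ *
      min (1 / 4 + (3 / 16 + p.2 0) * (p.1 : EuclideanSpace ℝ (Fin 3)) 0) 0)
    ((3 / 16 + p.2 0) * (p.1 : EuclideanSpace ℝ (Fin 3)) 1)
    ((3 / 16 + p.2 0) * (p.1 : EuclideanSpace ℝ (Fin 3)) 2)

theorem continuous_coordTileFun (κ : ℝ) : Continuous (coordTileFun κ) := by
  unfold coordTileFun tileFun
  fun_prop

theorem continuous_tileParam (φ : ℝ) : Continuous (tileParam φ) := by
  unfold tileParam obliquePoint
  refine (PiLp.continuous_toLp 2 _).comp (continuous_pi fun i => ?_)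
  fin_cases i <;> simp <;> fun_prop

theorem nonempty_homeomorph_coordTile {κ : ℝ} (hκ : -1 ≤ κ) (hκ' : κ ≤ 2) :
    Nonempty ({p | coordTileFun κ p ≤ 0} ≃ₜ
      Metric.sphere (0 : EuclideanSpace ℝ (Fin 3)) 1 ×
        Metric.closedBall (0 : EuclideanSpace ℝ (Fin 2)) 1) := by
  have hκ₂ : |κ| ≤ 2 := abs_le.2 ⟨by linarith, hκ'⟩
  have : CompactSpace (Metric.sphere (0 : EuclideanSpace ℝ (Fin 3)) 1) :=
    isCompact_iff_compactSpace.1 (isCompact_sphere 0 1)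
  refine nonempty_homeomorph_prod_closedBall_of_strictly_starShaped (continuous_coordTileFun κ)
    (M := 10) (fun u => ?_) (fun u v hv => ?_) fun u v hv r hr0 hr1 => ?_
  · simpa [coordTileFun] using tileFun_center_neg hκ₂ (sphere_three_sq_sum u)
  · refine le_of_abs_le (abs_le_of_sq_le_sq ?_ (by norm_num))
    rw [EuclideanSpace.real_norm_sq_eq, Fin.sum_univ_two]
    exact (bound_of_tileFun_nonpos hκ (sphere_three_sq_sum u) hv).trans (by norm_num)
  · exact tileFun_starShaped hκ₂ (sphere_three_sq_sum u) hr0 hr1 hv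

theorem tileParam_image {φ : ℝ} (hφ : 0 < Real.sin φ) :
    tileParam φ '' {p | coordTileFun (2 * Real.cos φ) p ≤ 0} = drilledWedge φ := by
  ext x
  constructor
  · rintro ⟨⟨u, v⟩, hp, rfl⟩
    obtain ⟨hN, ht, hρ, hs⟩ := tileFun_nonpos_iff.1 hp
    have hu := sphere_three_sq_sum u
    unfold tileParam
    dsimp only at *
    by_cases h : 0 ≤ 1 / 4 + (3 / 16 + v 0) * (u : EuclideanSpace ℝ (Fin 3)) 0
    · rw [abs_of_nonneg h] at hN
      rw [min_eq_right h, mul_zero, sub_zero]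
      refine Or.inl ⟨(obliquePoint_mem_ballWedge_iff hφ).2 ⟨ht, h, hN⟩, ?_⟩
      rw [Set.mem_ofPred_eq, tunnelDistSq_obliquePoint hφ]
      have := pow_le_pow_left₀ (by norm_num) hρ 2
      linear_combination this - (3 / 16 + v 0) ^ 2 * hu
    · push Not at h
      have hplug := hs.resolve_left (not_le.2 h)
      rw [abs_of_neg h] at hN
      rw [min_eq_left h.le]
      refine Or.inr ⟨obliquePoint φ (1 / 4 + v 1)
        (-(1 / 4 + (3 / 16 + v 0) * (u : EuclideanSpace ℝ (Fin 3)) 0))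
        ((3 / 16 + v 0) * (u : EuclideanSpace ℝ (Fin 3)) 1)
        ((3 / 16 + v 0) * (u : EuclideanSpace ℝ (Fin 3)) 2), ⟨?_, ?_⟩, ?_⟩
      · refine (obliquePoint_mem_ballWedge_iff hφ).2 ⟨by linarith, ht, ?_⟩
        linear_combination hN
      · rwa [Set.mem_ofPred_eq, tunnelDistSq_obliquePoint hφ]
      · rw [planeRotation_obliquePoint, neg_neg]
        congr 1
        ring
  · rintro (⟨hW, hR⟩ | ⟨y, ⟨hW, hR⟩, rfl⟩)
    · obtain ⟨s, t, c, d, rfl⟩ := exists_eq_obliquePoint hφ x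
      obtain ⟨ht, hs, hN⟩ := (obliquePoint_mem_ballWedge_iff hφ).1 hW
      rw [Set.mem_ofPred_eq, tunnelDistSq_obliquePoint hφ] at hR
      obtain ⟨u, ρ, hρ, h0, h1, h2⟩ := exists_spherical_coordinates hR
      refine ⟨(u, !₂[ρ - 3 / 16, t - 1 / 4]), ?_, ?_⟩
      · rw [Set.mem_ofPred_eq, coordTileFun, tileFun_nonpos_iff]
        simp [h0, h1, h2, abs_of_nonneg hs, ht, hN, hs]
        linarith
      · simp [tileParam, h0, h1, h2, hs]
    · obtain ⟨s, t, c, d, rfl⟩ := exists_eq_obliquePoint hφ y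
      obtain ⟨ht, hs, hN⟩ := (obliquePoint_mem_ballWedge_iff hφ).1 hW
      rw [Set.mem_ofPred_eq, tunnelDistSq_obliquePoint hφ] at hR
      obtain ⟨u, ρ, hρ, h0, h1, h2⟩ := exists_spherical_coordinates
        (show 1 / 256 ≤ (-t - 1 / 4) ^ 2 + c ^ 2 + d ^ 2 by nlinarith [sq_nonneg c, sq_nonneg d])
      refine ⟨(u, !₂[ρ - 3 / 16, s - 1 / 4]), ?_, ?_⟩
      · rw [Set.mem_ofPred_eq, coordTileFun, tileFun_nonpos_iff]
        simp [h0, h1, h2, abs_of_nonneg ht, hs]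
        refine ⟨by linear_combination hN, by linarith, Or.inr ?_⟩
        simpa using hR
      · rw [planeRotation_obliquePoint]
        simp [tileParam, h0, h1, h2, ht]

theorem tileParam_injOn {φ : ℝ} (hφ : 0 < Real.sin φ) :
    Set.InjOn (tileParam φ) {p | coordTileFun (2 * Real.cos φ) p ≤ 0} := by
  rintro ⟨u, v⟩ hp ⟨u', v'⟩ hp' h
  have hρ := (tileFun_nonpos_iff.1 hp).2.2.1
  have hρ' := (tileFun_nonpos_iff.1 hp').2.2.1
  have hu := sphere_three_sq_sum u
  have hu' := sphere_three_sq_sum u'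
  obtain ⟨h0, ht, h1, h2⟩ := obliquePoint_injective hφ h
  dsimp only at *
  rw [h0] at ht
  have h0' := add_left_cancel h0
  have hsq : (3 / 16 + v 0) ^ 2 = (3 / 16 + v' 0) ^ 2 := by
    have e (r a b c : ℝ) (h : a ^ 2 + b ^ 2 + c ^ 2 = 1) :
        r ^ 2 = (r * a) ^ 2 + (r * b) ^ 2 + (r * c) ^ 2 := by
      linear_combination (-r ^ 2) * h
    refine (e (3 / 16 + v 0) _ _ _ hu).trans ?_
    rw [h0', h1, h2]
    exact (e _ _ _ _ hu').symm
  have hv : 3 / 16 + v 0 = 3 / 16 + v' 0 :=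
    (pow_left_inj₀ (by linarith) (by linarith) two_ne_zero).1 hsq
  have hne : 3 / 16 + v' 0 ≠ 0 := by linarith
  rw [hv] at h0' h1 h2
  refine Prod.ext (Subtype.ext ?_) ?_
  · ext i
    fin_cases i
    exacts [mul_left_cancel₀ hne h0', mul_left_cancel₀ hne h1, mul_left_cancel₀ hne h2]
  · ext i
    fin_cases i
    exacts [add_left_cancel hv, by simpa using ht]

theorem nonempty_homeomorph_drilledWedge {φ : ℝ} (hφ : 0 < Real.sin φ)
    (hκ : -1 ≤ 2 * Real.cos φ) :
    Nonempty (drilledWedge φ ≃ₜ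
      Metric.sphere (0 : EuclideanSpace ℝ (Fin 3)) 1 ×
        Metric.closedBall (0 : EuclideanSpace ℝ (Fin 2)) 1) := by
  obtain ⟨e⟩ := nonempty_homeomorph_coordTile hκ (by linarith [Real.cos_le_one φ])
  have : CompactSpace (Metric.sphere (0 : EuclideanSpace ℝ (Fin 3)) 1) :=
    isCompact_iff_compactSpace.1 (isCompact_sphere 0 1)
  have : CompactSpace (Metric.closedBall (0 : EuclideanSpace ℝ (Fin 2)) 1) :=
    isCompact_iff_compactSpace.1 (isCompact_closedBall 0 1)
  have := e.symm.compactSpace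
  have hemb := (((continuous_tileParam φ).continuousOn.domRestrict (s := {p |
    coordTileFun (2 * Real.cos φ) p ≤ 0})).isClosedEmbedding
    (tileParam_injOn hφ).injective).isEmbedding
  have hrange := (Set.range_domRestrict (tileParam φ)
    {p | coordTileFun (2 * Real.cos φ) p ≤ 0}).trans (tileParam_image hφ)
  exact ⟨((Homeomorph.setCongr hrange).symm.trans hemb.toHomeomorph.symm).trans e⟩

theorem interior_drilledWedge_nonempty {φ : ℝ} (hφ : 0 < Real.sin φ) :
    (interior (drilledWedge φ)).Nonempty := by
  have hopen : IsOpen {x : EuclideanSpace ℝ (Fin 4) | 0 < x 1 ∧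
      0 < x 0 * Real.sin φ - x 1 * Real.cos φ ∧ ‖x‖ < 1 ∧ 1 / 256 < tunnelDistSq φ x} := by
    unfold tunnelDistSq
    exact IsOpen.and (isOpen_lt (by fun_prop) (by fun_prop)) (IsOpen.and
      (isOpen_lt (by fun_prop) (by fun_prop)) (IsOpen.and
        (isOpen_lt (by fun_prop) (by fun_prop)) (isOpen_lt (by fun_prop) (by fun_prop))))
  refine ⟨obliquePoint φ (1 / 4) (1 / 4) (1 / 8) 0, interior_maximal ?_ hopen ?_⟩
  · rintro x ⟨h1, h0, hn, ht⟩
    exact Or.inl ⟨⟨h1.le, h0.le, hn.le⟩, ht.le⟩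
  · refine ⟨by simpa [obliquePoint] using hφ, ?_, ?_, ?_⟩
    · have : (1 / 4 + 1 / 4 * Real.cos φ) * Real.sin φ - 1 / 4 * Real.sin φ * Real.cos φ
          = 1 / 4 * Real.sin φ := by ring
      have h : 0 < (1 / 4 + 1 / 4 * Real.cos φ) * Real.sin φ
          - 1 / 4 * Real.sin φ * Real.cos φ := by rw [this]; positivity
      exact h
    · have h2 := Real.sin_sq_add_cos_sq φ
      rw [← sq_lt_one_iff₀ (norm_nonneg _), EuclideanSpace.real_norm_sq_eq]
      simp only [Fin.sum_univ_four, obliquePoint]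
      simp
      nlinarith [Real.cos_le_one φ]
    · rw [tunnelDistSq_obliquePoint hφ]
      norm_num

/-- A set is dense if every point lies on a line along which only finitely many points are
missing from the set. -/
theorem dense_of_finite_compl_on_lines {E : Type*} [NormedAddCommGroup E] [NormedSpace ℝ E]
    {s : Set E} (h : ∀ x, ∃ v : E, {r : ℝ | x + r • v ∉ s}.Finite) : Dense s := by
  intro x
  obtain ⟨v, hv⟩ := h x
  have hd := hv.countable.dense_compl ℝ (0 : ℝ)
  have hc : Continuous fun r : ℝ => x + r • v := by fun_prop
  have := hc.closure_preimage_subset s (closure_mono (fun r hr => by simpa using hr) hd)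
  simpa using this

/-- The points that avoid the walls of the wedge and the boundary of the tunnel. -/
def offWalls (φ : ℝ) : Set (EuclideanSpace ℝ (Fin 4)) :=
  {x | x 1 ≠ 0} ∩ ({x | x 0 * Real.sin φ - x 1 * Real.cos φ ≠ 0} ∩
    {x | tunnelDistSq φ x ≠ 1 / 256})

theorem isOpen_offWalls (φ : ℝ) : IsOpen (offWalls φ) := by
  unfold offWalls tunnelDistSq
  refine (isOpen_ne_fun ?_ ?_).inter ((isOpen_ne_fun ?_ ?_).inter (isOpen_ne_fun ?_ ?_)) <;>
    fun_prop

theorem dense_offWalls {φ : ℝ} (hφ : 0 < Real.sin φ) : Dense (offWalls φ) := by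
  refine Dense.inter_of_isOpen_left ?_ (Dense.inter_of_isOpen_left ?_ ?_ ?_) ?_
  · refine dense_of_finite_compl_on_lines fun x => ⟨EuclideanSpace.single 1 1, ?_⟩
    refine (Set.finite_singleton (-x 1)).subset fun r hr => ?_
    have : x 1 + r = 0 := by simpa using hr
    simp only [Set.mem_singleton_iff]
    linarith
  · refine dense_of_finite_compl_on_lines fun x => ⟨EuclideanSpace.single 0 1, ?_⟩
    refine (Set.finite_singleton (x 1 * Real.cos φ / Real.sin φ - x 0)).subset fun r hr => ?_
    have : (x 0 + r) * Real.sin φ - x 1 * Real.cos φ = 0 := by simpa using hr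
    rw [Set.mem_singleton_iff, eq_sub_iff_add_eq, eq_div_iff hφ.ne']
    linarith
  · refine dense_of_finite_compl_on_lines fun x => ⟨EuclideanSpace.single 3 1, ?_⟩
    set C := 1 / 256 - (((x 0 * Real.sin φ - x 1 * Real.cos φ) / Real.sin φ - 1 / 4) ^ 2
      + x 2 ^ 2) with hC
    refine (Set.toFinite {√C - x 3, -√C - x 3}).subset fun r hr => ?_
    have h : ((x 0 * Real.sin φ - x 1 * Real.cos φ) / Real.sin φ - 1 / 4) ^ 2 + x 2 ^ 2
        + (x 3 + r) ^ 2 = 1 / 256 := by simpa [tunnelDistSq] using hr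
    have hsq : (x 3 + r) ^ 2 = C := by rw [hC]; linarith
    have hC0 : 0 ≤ C := hsq ▸ sq_nonneg _
    rcases sq_eq_sq_iff_eq_or_eq_neg.1 (hsq.trans (Real.sq_sqrt hC0).symm) with h | h
    · left; linarith
    · right; rw [Set.mem_singleton_iff]; linarith
  · exact isOpen_ne_fun (by fun_prop) (by fun_prop)
  · exact isOpen_ne_fun (by fun_prop) (by fun_prop)

theorem exists_polar (x : EuclideanSpace ℝ (Fin 4)) :
    ∃ r θ : ℝ, 0 ≤ r ∧ x 0 = r * Real.cos θ ∧ x 1 = r * Real.sin θ := by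
  refine ⟨‖(⟨x 0, x 1⟩ : ℂ)‖, Complex.arg ⟨x 0, x 1⟩, norm_nonneg _, ?_, ?_⟩
  · rw [Complex.norm_mul_cos_arg]
  · rw [Complex.norm_mul_sin_arg]

theorem planeRotation_neg_apply_one {x : EuclideanSpace ℝ (Fin 4)} {r θ α : ℝ}
    (h0 : x 0 = r * Real.cos θ) (h1 : x 1 = r * Real.sin θ) :
    planeRotation (-α) x 1 = r * Real.sin (θ - α) := by
  simp [planeRotation_apply, h0, h1, Real.sin_sub]
  ring

theorem planeRotation_neg_side {x : EuclideanSpace ℝ (Fin 4)} {r θ α : ℝ} (φ : ℝ)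
    (h0 : x 0 = r * Real.cos θ) (h1 : x 1 = r * Real.sin θ) :
    planeRotation (-α) x 0 * Real.sin φ - planeRotation (-α) x 1 * Real.cos φ
      = r * Real.sin (φ - (θ - α)) := by
  rw [planeRotation_neg_apply_one h0 h1, Real.sin_sub φ, Real.cos_sub θ]
  simp [planeRotation_apply, h0, h1]
  ring

/-- An angle strictly inside the sector of opening `φ`, up to a multiple of `2π`. -/
theorem exists_int_sub_mem_Ioo {φ α : ℝ} (h : 0 < Real.sin α)
    (h' : 0 < Real.sin (φ - α)) (hφ0 : 0 < φ) :
    ∃ m : ℤ, 0 < α - m * (2 * Real.pi) ∧ α - m * (2 * Real.pi) < φ := by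
  have hpi := Real.two_pi_pos
  refine ⟨⌊α / (2 * Real.pi)⌋, ?_⟩
  set m := ⌊α / (2 * Real.pi)⌋
  have hl : m * (2 * Real.pi) ≤ α := (le_div_iff₀ hpi).1 (Int.floor_le _)
  have hu : α < (m + 1) * (2 * Real.pi) := (div_lt_iff₀ hpi).1 (Int.lt_floor_add_one _)
  rw [← Real.sin_sub_int_mul_two_pi α m] at h
  rw [← Real.sin_add_int_mul_two_pi _ m,
    show φ - α + m * (2 * Real.pi) = -(α - m * (2 * Real.pi) - φ) by ring, Real.sin_neg] at h'
  set β := α - m * (2 * Real.pi)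
  have hβ : β < Real.pi := by
    by_contra! hle
    have := Real.sin_nonneg_of_nonneg_of_le_pi (x := β - Real.pi) (by linarith) (by linarith)
    rw [Real.sin_sub_pi] at this
    linarith
  constructor
  · refine lt_of_le_of_ne (by linarith) fun h0 => ?_
    rw [← h0, Real.sin_zero] at h
    exact lt_irrefl _ h
  · by_contra! hle
    have := Real.sin_nonneg_of_nonneg_of_le_pi (x := β - φ) (by linarith) (by linarith)
    linarith

/-- The interior of the wedge is disjoint from its nontrivial rotations. -/
theorem exists_int_of_mem_interior_wedges {n : ℕ} (hn : 3 ≤ n) {φ : ℝ}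
    (hφ : n * φ = 2 * Real.pi) {x : EuclideanSpace ℝ (Fin 4)} {j k : ℕ}
    (hj : 0 < planeRotation (-(j * φ)) x 1)
    (hj' : 0 < planeRotation (-(j * φ)) x 0 * Real.sin φ
      - planeRotation (-(j * φ)) x 1 * Real.cos φ)
    (hk : 0 < planeRotation (-(k * φ)) x 1)
    (hk' : 0 < planeRotation (-(k * φ)) x 0 * Real.sin φ
      - planeRotation (-(k * φ)) x 1 * Real.cos φ) : ∃ m : ℤ, (j : ℤ) = k + n * m := by
  have hn' : (3 : ℝ) ≤ n := by exact_mod_cast hn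
  have hφ0 : 0 < φ := pos_of_mul_pos_right (hφ ▸ Real.two_pi_pos) (by linarith)
  obtain ⟨r, θ, hr, h0, h1⟩ := exists_polar x
  rw [planeRotation_neg_side φ h0 h1] at hj' hk'
  rw [planeRotation_neg_apply_one h0 h1] at hj hk
  obtain ⟨a, ha, ha'⟩ := exists_int_sub_mem_Ioo (pos_of_mul_pos_right hj hr)
    (pos_of_mul_pos_right hj' hr) hφ0
  obtain ⟨b, hb, hb'⟩ := exists_int_sub_mem_Ioo (pos_of_mul_pos_right hk hr)
    (pos_of_mul_pos_right hk' hr) hφ0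
  rw [← hφ] at ha ha' hb hb'
  refine ⟨b - a, ?_⟩
  have key1 : ((j : ℝ) - k - n * (b - a)) * φ < 1 * φ := by linarith
  have key2 : (-1) * φ < ((j : ℝ) - k - n * (b - a)) * φ := by linarith
  have c1 := lt_of_mul_lt_mul_right key1 hφ0.le
  have c2 := lt_of_mul_lt_mul_right key2 hφ0.le
  have d1 : (j : ℤ) - k - n * (b - a) < 1 := by exact_mod_cast c1
  have d2 : -1 < (j : ℤ) - k - n * (b - a) := by exact_mod_cast c2
  linarith [show (j : ℤ) - k - n * (b - a) = 0 by omega]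

/-- The rotated wedges cover the ball. -/
theorem exists_mem_ballWedge {n : ℕ} (hn : 3 ≤ n) {φ : ℝ} (hφ : n * φ = 2 * Real.pi)
    {x : EuclideanSpace ℝ (Fin 4)} (hx : ‖x‖ ≤ 1) :
    ∃ k : ℕ, k < n ∧ planeRotation (-(k * φ)) x ∈ ballWedge φ := by
  have hn' : (3 : ℝ) ≤ n := by exact_mod_cast hn
  have hpi := Real.pi_pos
  have hφ0 : 0 < φ := pos_of_mul_pos_right (hφ ▸ Real.two_pi_pos) (by linarith)
  have hφπ : φ < Real.pi := by nlinarith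
  obtain ⟨r, θ, hr, h0, h1⟩ := exists_polar x
  have hn0 : (0 : ℤ) < n := by omega
  set f : ℤ := ⌊θ / φ⌋
  have hl : f * φ ≤ θ := (le_div_iff₀ hφ0).1 (Int.floor_le _)
  have hu : θ < (f + 1) * φ := (div_lt_iff₀ hφ0).1 (Int.lt_floor_add_one _)
  obtain ⟨k, hk⟩ := Int.eq_ofNat_of_zero_le (Int.emod_nonneg f hn0.ne')
  have hkn : (k : ℤ) < n := hk ▸ Int.emod_lt_of_pos f hn0
  have hf : (f : ℝ) = k + n * (f / n : ℤ) := by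
    have : f = k + n * (f / n) := by rw [← hk]; exact (Int.emod_add_mul_ediv f n).symm
    exact_mod_cast this
  have hrot : planeRotation (-(k * φ)) x = planeRotation (-(f * φ)) x := by
    rw [← planeRotation_add_int_mul_two_pi (-(f * φ)) (f / n), ← hφ]
    congr 2
    linear_combination φ * hf
  refine ⟨k, by exact_mod_cast hkn, ?_⟩
  rw [hrot]
  refine ⟨?_, ?_, by rwa [norm_planeRotation]⟩
  · rw [planeRotation_neg_apply_one h0 h1]
    exact mul_nonneg hr (Real.sin_nonneg_of_nonneg_of_le_pi (by linarith) (by linarith))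
  · rw [planeRotation_neg_side φ h0 h1]
    exact mul_nonneg hr (Real.sin_nonneg_of_nonneg_of_le_pi (by linarith) (by linarith))

theorem drilledWedge_subset_closedBall (φ : ℝ) : drilledWedge φ ⊆ Metric.closedBall 0 1 := by
  rintro x (⟨h, -⟩ | ⟨y, ⟨h, -⟩, rfl⟩)
  · simpa using h.2.2
  · rw [mem_closedBall_zero_iff, norm_planeRotation]
    exact h.2.2

theorem iUnion_planeRotation_image_drilledWedge {n : ℕ} (hn : 3 ≤ n) {φ : ℝ}
    (hφ : n * φ = 2 * Real.pi) :
    ⋃ i : Fin n, planeRotation ((i : ℕ) * φ) '' drilledWedge φ = Metric.closedBall 0 1 := by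
  refine Set.Subset.antisymm (Set.iUnion_subset fun i => ?_) fun x hx => ?_
  · rintro _ ⟨y, hy, rfl⟩
    rw [mem_closedBall_zero_iff, norm_planeRotation]
    simpa using drilledWedge_subset_closedBall φ hy
  · rw [mem_closedBall_zero_iff] at hx
    obtain ⟨k, hk, hkx⟩ := exists_mem_ballWedge hn hφ hx
    rw [Set.mem_iUnion]
    rcases le_total (1 / 256) (tunnelDistSq φ (planeRotation (-(k * φ)) x)) with h | h
    · exact ⟨⟨k, hk⟩, mem_planeRotation_image.2 (Or.inl ⟨hkx, h⟩)⟩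
    · have shift (j : ℕ) (hj : j < n)
          (e : planeRotation (-φ) (planeRotation (-(j * φ)) x) = planeRotation (-(k * φ)) x) :
          ∃ i : Fin n, x ∈ planeRotation ((i : ℕ) * φ) '' drilledWedge φ :=
        ⟨⟨j, hj⟩, mem_planeRotation_image.2 (Or.inr (mem_planeRotation_image.2
          (by rw [e]; exact ⟨hkx, h⟩)))⟩
      cases k with
      | zero =>
        refine shift (n - 1) (by omega) ?_
        rw [planeRotation_planeRotation, ← planeRotation_add_int_mul_two_pi _ 1, ← hφ,
          Nat.cast_sub (by omega)]
        congr 2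
        push_cast
        ring
      | succ j =>
        refine shift j (by omega) ?_
        rw [planeRotation_planeRotation]
        congr 2
        push_cast
        ring

/-- A generic point of the `i`-th tile lies in the interior of a rotated wedge, outside of the
tunnel if this is the `i`-th wedge, and inside of it if this is the next one. -/
theorem generic_mem_planeRotation_image_drilledWedge {φ : ℝ} {x : EuclideanSpace ℝ (Fin 4)}
    (hx : ∀ k : ℕ, planeRotation (-(k * φ)) x ∈ offWalls φ) {i : ℕ}
    (hi : x ∈ planeRotation (i * φ) '' drilledWedge φ) :
    ∃ k : ℕ, 0 < planeRotation (-(k * φ)) x 1 ∧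
      0 < planeRotation (-(k * φ)) x 0 * Real.sin φ - planeRotation (-(k * φ)) x 1 * Real.cos φ ∧
      (k = i ∧ 1 / 256 < tunnelDistSq φ (planeRotation (-(k * φ)) x) ∨
        k = i + 1 ∧ tunnelDistSq φ (planeRotation (-(k * φ)) x) < 1 / 256) := by
  rcases mem_planeRotation_image.1 hi with ⟨h, ht⟩ | h
  · obtain ⟨h1, h0, h2⟩ := hx i
    exact ⟨i, lt_of_le_of_ne h.1 (Ne.symm h1), lt_of_le_of_ne h.2.1 (Ne.symm h0),
      Or.inl ⟨rfl, lt_of_le_of_ne ht (Ne.symm h2)⟩⟩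
  · rw [mem_planeRotation_image, planeRotation_planeRotation,
      show -φ + -(i * φ) = -((i + 1 : ℕ) * φ) by push_cast; ring] at h
    obtain ⟨h, ht⟩ := h
    obtain ⟨h1, h0, h2⟩ := hx (i + 1)
    exact ⟨i + 1, lt_of_le_of_ne h.1 (Ne.symm h1), lt_of_le_of_ne h.2.1 (Ne.symm h0),
      Or.inr ⟨rfl, lt_of_le_of_ne ht h2⟩⟩

theorem interior_inter_interior_planeRotation_drilledWedge {n : ℕ} (hn : 3 ≤ n) {φ : ℝ}
    (hsin : 0 < Real.sin φ) (hφ : n * φ = 2 * Real.pi) {i j : Fin n} (hij : i ≠ j) :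
    interior (planeRotation ((i : ℕ) * φ) '' drilledWedge φ) ∩
      interior (planeRotation ((j : ℕ) * φ) '' drilledWedge φ) = ∅ := by
  have hdense : Dense (⋂ k : ℕ, planeRotation (-(k * φ)) ⁻¹' offWalls φ) :=
    dense_iInter_of_isOpen
      (fun k => (isOpen_offWalls φ).preimage (planeRotation _).continuous)
      fun k => (dense_offWalls hsin).preimage (planeRotation _).toHomeomorph.isOpenMap
  by_contra! hne
  obtain ⟨x, ⟨hxi, hxj⟩, hx⟩ :=
    hdense.inter_open_nonempty _ (isOpen_interior.inter isOpen_interior) hne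
  rw [Set.mem_iInter] at hx
  obtain ⟨a, ha, ha', hat⟩ := generic_mem_planeRotation_image_drilledWedge hx
    (interior_subset hxi)
  obtain ⟨b, hb, hb', hbt⟩ := generic_mem_planeRotation_image_drilledWedge hx
    (interior_subset hxj)
  obtain ⟨m, hm⟩ := exists_int_of_mem_interior_wedges hn hφ ha ha' hb hb'
  have hrot : planeRotation (-(a * φ)) x = planeRotation (-(b * φ)) x := by
    rw [← planeRotation_add_int_mul_two_pi _ m, ← hφ]
    congr 2
    have : (a : ℝ) = b + n * m := by exact_mod_cast hm
    linear_combination (-φ) * this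
  rw [hrot] at hat
  have hmod : (i : ℤ) - j = n * m := by
    rcases hat with ⟨rfl, h⟩ | ⟨rfl, h⟩ <;> rcases hbt with ⟨rfl, h'⟩ | ⟨rfl, h'⟩
    · linarith
    · exact (lt_asymm h h').elim
    · exact (lt_asymm h h').elim
    · push_cast at hm; linarith
  have hi := i.2
  have hj := j.2
  have hz : (i : ℤ) - j = 0 :=
    Int.eq_zero_of_abs_lt_dvd ⟨m, hmod⟩ (abs_lt.2 ⟨by omega, by omega⟩)
  exact hij (Fin.ext (by omega))


/-- **4D Tiling Theorem (sphere case).** For every `n ≥ 3`, the closed unit ball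
`B⁴ ⊆ ℝ⁴` admits a monohedral tiling by `n` tiles, each homeomorphic to `S² × D²`. -/
theorem unitBall4_monohedral_tiling_sphere_times_disk (n : ℕ) (hn : 3 ≤ n) :
    ∃ T : Fin n → Set (EuclideanSpace ℝ (Fin 4)),
      (⋃ i, T i) = Metric.closedBall (0 : EuclideanSpace ℝ (Fin 4)) 1 ∧
      (∀ i, IsCompact (T i)) ∧
      (∀ i, IsConnected (T i)) ∧
      (∀ i, (interior (T i)).Nonempty) ∧
      (∀ i j, i ≠ j → interior (T i) ∩ interior (T j) = ∅) ∧
      (∀ i j, ∃ f : EuclideanSpace ℝ (Fin 4) ≃ᵢ EuclideanSpace ℝ (Fin 4),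
        f '' (T i) = T j) ∧
      (∀ i, Nonempty ((T i) ≃ₜ
        (Metric.sphere (0 : EuclideanSpace ℝ (Fin 3)) 1 ×
          Metric.closedBall (0 : EuclideanSpace ℝ (Fin 2)) 1))) := by
  have hn' : (3 : ℝ) ≤ n := by exact_mod_cast hn
  have hpi := Real.pi_pos
  set φ : ℝ := 2 * Real.pi / n with hφdef
  have hφ : n * φ = 2 * Real.pi := mul_div_cancel₀ _ (by linarith)
  have hφ0 : 0 < φ := by positivity
  have hφ3 : φ ≤ Real.pi - Real.pi / 3 := by nlinarith
  have hsin : 0 < Real.sin φ := Real.sin_pos_of_pos_of_lt_pi hφ0 (by linarith)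
  have hcos : -1 ≤ 2 * Real.cos φ := by
    have := Real.cos_le_cos_of_nonneg_of_le_pi hφ0.le (by linarith) hφ3
    rw [Real.cos_pi_sub, Real.cos_pi_div_three] at this
    linarith
  obtain ⟨e⟩ := nonempty_homeomorph_drilledWedge hsin hcos
  have : CompactSpace (Metric.sphere (0 : EuclideanSpace ℝ (Fin 3)) 1) :=
    isCompact_iff_compactSpace.1 (isCompact_sphere 0 1)
  have : CompactSpace (Metric.closedBall (0 : EuclideanSpace ℝ (Fin 2)) 1) :=
    isCompact_iff_compactSpace.1 (isCompact_closedBall 0 1)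
  have : ConnectedSpace (Metric.sphere (0 : EuclideanSpace ℝ (Fin 3)) 1) :=
    isConnected_iff_connectedSpace.1 (isConnected_sphere (by
      rw [← Module.finrank_eq_rank, finrank_euclideanSpace_fin]; norm_num) 0 zero_le_one)
  have : ConnectedSpace (Metric.closedBall (0 : EuclideanSpace ℝ (Fin 2)) 1) :=
    isConnected_iff_connectedSpace.1 ((convex_closedBall 0 1).isConnected
      (Metric.nonempty_closedBall.2 zero_le_one))
  have hcompact : IsCompact (drilledWedge φ) :=
    isCompact_iff_compactSpace.2 e.symm.compactSpace
  have hconn : IsConnected (drilledWedge φ) :=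
    isConnected_iff_connectedSpace.2 (e.symm.surjective.connectedSpace e.symm.continuous)
  refine ⟨fun i => planeRotation ((i : ℕ) * φ) '' drilledWedge φ,
    iUnion_planeRotation_image_drilledWedge hn hφ,
    fun i => hcompact.image (planeRotation _).continuous,
    fun i => hconn.image _ (planeRotation _).continuous.continuousOn, fun i => ?_,
    fun i j hij => interior_inter_interior_planeRotation_drilledWedge hn hsin hφ hij,
    fun i j => ⟨(planeRotation ((i : ℕ) * φ)).symm.trans (planeRotation ((j : ℕ) * φ)), ?_⟩,
    fun i => ⟨((planeRotation ((i : ℕ) * φ)).toHomeomorph.image _).symm.trans e⟩⟩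
  · have := (planeRotation ((i : ℕ) * φ)).toHomeomorph.image_interior (drilledWedge φ)
    exact this ▸ (interior_drilledWedge_nonempty hsin).image _
  · rw [Set.image_image]
    simp
end

section
/- The closed unit ball B⁴ = {x ∈ ℝ⁴ : ‖x‖ ≤ 1} can be written as the union of three compact, connected subsets with pairwise disjoint, nonempty interiors, such that two of the subsets are homeomorphic (with their subspace topologies) to the closed unit ball in ℝ⁴, and the third is homeomorphic to S² × D², where S² = {v ∈ ℝ³ : ‖v‖ = 1} and D² = {v ∈ ℝ² : ‖v‖ ≤ 1}. (This is the Complement Covering Theorem in the case where the surface F is a 2-sphere, recorded up to homeomorphism type of the pieces.) -/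
open Metric Set in
/-- A compact convex set with nonempty interior is homeomorphic to the closed unit ball. -/
theorem Convex.nonempty_homeomorph_closedBall {E : Type*} [NormedAddCommGroup E]
    [NormedSpace ℝ E] {s : Set E} (hs : Convex ℝ s) (hc : IsCompact s)
    (hne : (interior s).Nonempty) : Nonempty (s ≃ₜ closedBall (0 : E) 1) := by
  obtain ⟨h, -, h2, -⟩ :=
    exists_homeomorph_image_interior_closure_frontier_eq_unitBall hs hne hc.isBounded
  rw [hc.isClosed.closure_eq] at h2
  exact ⟨(h.image s).trans (Homeomorph.setCongr h2)⟩

/-- A set not containing any nontrivial translate `p + ε • v` of its points `p` along a direction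
`v p` has empty interior. -/
theorem interior_eq_empty_of_forall_add_smul_notMem {E : Type*} [NormedAddCommGroup E]
    [NormedSpace ℝ E] {s : Set E} (v : E → E)
    (h : ∀ p ∈ s, ∀ ε : ℝ, 0 < ε → p + ε • v p ∉ s) : interior s = ∅ := by
  by_contra hne
  obtain ⟨p, hp⟩ := Set.nonempty_iff_ne_empty.2 hne
  have hcont : Filter.Tendsto (fun ε : ℝ => p + ε • v p) (nhdsWithin 0 (Set.Ioi 0)) (nhds p) := by
    have : Continuous fun ε : ℝ => p + ε • v p := by fun_prop
    simpa using (this.tendsto 0).mono_left nhdsWithin_le_nhds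
  have hev := hcont.eventually (isOpen_interior.mem_nhds hp)
  obtain ⟨ε, h1, h2⟩ := (hev.and self_mem_nhdsWithin).exists
  exact h p (interior_subset hp) ε h2 (interior_subset h1)

namespace FourBall

/-- The projection of `ℝ⁴` onto its first three coordinates. -/
noncomputable def proj : EuclideanSpace ℝ (Fin 4) →ₗ[ℝ] EuclideanSpace ℝ (Fin 3) where
  toFun p := !₂[p 0, p 1, p 2]
  map_add' p q := by ext i; fin_cases i <;> simp
  map_smul' c p := by ext i; fin_cases i <;> simp

/-- The point of `ℝ⁴` with first three coordinates `x` and last coordinate `t`. -/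
noncomputable def glue (x : EuclideanSpace ℝ (Fin 3)) (t : ℝ) : EuclideanSpace ℝ (Fin 4) :=
  !₂[x 0, x 1, x 2, t]

theorem proj_glue (x : EuclideanSpace ℝ (Fin 3)) (t : ℝ) : proj (glue x t) = x := by
  ext i; fin_cases i <;> simp [proj, glue]

theorem glue_last (x : EuclideanSpace ℝ (Fin 3)) (t : ℝ) : glue x t 3 = t := by
  simp [glue]

theorem glue_proj (p : EuclideanSpace ℝ (Fin 4)) : glue (proj p) (p 3) = p := by
  ext i; fin_cases i <;> simp [proj, glue]

theorem norm_sq_eq_proj (p : EuclideanSpace ℝ (Fin 4)) : ‖p‖ ^ 2 = ‖proj p‖ ^ 2 + p 3 ^ 2 := by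
  simp [EuclideanSpace.real_norm_sq_eq, Fin.sum_univ_succ, proj]
  ring

theorem mem_closedBall_iff_proj (p : EuclideanSpace ℝ (Fin 4)) :
    p ∈ Metric.closedBall (0 : EuclideanSpace ℝ (Fin 4)) 1 ↔ ‖proj p‖ ^ 2 + p 3 ^ 2 ≤ 1 := by
  rw [← norm_sq_eq_proj, mem_closedBall_zero_iff, sq_le_one_iff₀ (norm_nonneg _)]

theorem continuous_proj : Continuous proj := proj.continuous_of_finiteDimensional

theorem continuous_coord {n : ℕ} (i : Fin n) :
    Continuous fun p : EuclideanSpace ℝ (Fin n) => p i := by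
  fun_prop

theorem continuous_norm_proj_sq_add :
    Continuous fun p : EuclideanSpace ℝ (Fin 4) => ‖proj p‖ ^ 2 + p 3 ^ 2 :=
  (continuous_proj.norm.pow 2).add ((continuous_coord 3).pow 2)

theorem continuous_glue :
    Continuous fun q : EuclideanSpace ℝ (Fin 3) × ℝ => glue q.1 q.2 := by
  refine (PiLp.continuous_toLp 2 _).comp (continuous_pi fun i => ?_)
  fin_cases i <;> simp <;> fun_prop

/-- The upper half of the solid core of the unit ball. -/
def upperCore : Set (EuclideanSpace ℝ (Fin 4)) :=
  {p | p ∈ Metric.closedBall (0 : EuclideanSpace ℝ (Fin 4)) 1 ∧ ‖proj p‖ ≤ 1 / 2 ∧ 0 ≤ p 3}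

/-- The lower half of the solid core of the unit ball. -/
def lowerCore : Set (EuclideanSpace ℝ (Fin 4)) :=
  {p | p ∈ Metric.closedBall (0 : EuclideanSpace ℝ (Fin 4)) 1 ∧ ‖proj p‖ ≤ 1 / 2 ∧ p 3 ≤ 0}

/-- The part of the unit ball outside the solid core. -/
def shell : Set (EuclideanSpace ℝ (Fin 4)) :=
  {p | p ∈ Metric.closedBall (0 : EuclideanSpace ℝ (Fin 4)) 1 ∧ 1 / 2 ≤ ‖proj p‖}

/-- The planar region whose rotation about an axis in `ℝ⁴` is the shell. -/
def profile : Set (EuclideanSpace ℝ (Fin 2)) :=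
  {k | k ∈ Metric.closedBall (0 : EuclideanSpace ℝ (Fin 2)) 1 ∧ 1 / 2 ≤ k 0}

theorem mem_profile_iff (k : EuclideanSpace ℝ (Fin 2)) :
    k ∈ profile ↔ k 0 ^ 2 + k 1 ^ 2 ≤ 1 ∧ 1 / 2 ≤ k 0 := by
  rw [profile, Set.mem_ofPred_eq, mem_closedBall_zero_iff, ← sq_le_one_iff₀ (norm_nonneg _),
    EuclideanSpace.real_norm_sq_eq, Fin.sum_univ_two]

theorem isClosed_upperCore : IsClosed upperCore :=
  Metric.isClosed_closedBall.inter <|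
    (isClosed_le continuous_proj.norm continuous_const).inter
      (isClosed_le continuous_const (continuous_coord 3))

theorem isClosed_lowerCore : IsClosed lowerCore :=
  Metric.isClosed_closedBall.inter <|
    (isClosed_le continuous_proj.norm continuous_const).inter
      (isClosed_le (continuous_coord 3) continuous_const)

theorem isClosed_shell : IsClosed shell :=
  Metric.isClosed_closedBall.inter (isClosed_le continuous_const continuous_proj.norm)

theorem isClosed_profile : IsClosed profile :=
  Metric.isClosed_closedBall.inter (isClosed_le continuous_const (continuous_coord 0))

theorem convex_norm_proj_le (r : ℝ) : Convex ℝ {p | ‖proj p‖ ≤ r} := by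
  have h := (convex_closedBall (0 : EuclideanSpace ℝ (Fin 3)) r).linear_preimage proj
  rwa [show proj ⁻¹' Metric.closedBall 0 r = {p | ‖proj p‖ ≤ r} from
    Set.ext fun p => mem_closedBall_zero_iff] at h

theorem convex_upperCore : Convex ℝ upperCore :=
  (convex_closedBall _ _).inter <| (convex_norm_proj_le _).inter
    (convex_halfSpace_ge (EuclideanSpace.proj (𝕜 := ℝ) (3 : Fin 4)).isLinear 0)

theorem convex_lowerCore : Convex ℝ lowerCore :=
  (convex_closedBall _ _).inter <| (convex_norm_proj_le _).inter
    (convex_halfSpace_le (EuclideanSpace.proj (𝕜 := ℝ) (3 : Fin 4)).isLinear 0)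

theorem convex_profile : Convex ℝ profile :=
  (convex_closedBall _ _).inter
    (convex_halfSpace_ge (EuclideanSpace.proj (𝕜 := ℝ) (0 : Fin 2)).isLinear _)

theorem interior_upperCore_nonempty : (interior upperCore).Nonempty := by
  refine ⟨glue 0 (1 / 2), mem_interior.2
    ⟨{p | ‖proj p‖ ^ 2 + p 3 ^ 2 < 1 ∧ ‖proj p‖ < 1 / 2 ∧ 0 < p 3}, ?_, ?_, ?_⟩⟩
  · rintro p ⟨h1, h2, h3⟩
    exact ⟨(mem_closedBall_iff_proj p).2 h1.le, h2.le, h3.le⟩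
  · exact (isOpen_lt continuous_norm_proj_sq_add continuous_const).inter <|
      (isOpen_lt continuous_proj.norm continuous_const).inter
        (isOpen_lt continuous_const (continuous_coord 3))
  · norm_num [proj_glue, glue_last]

theorem interior_lowerCore_nonempty : (interior lowerCore).Nonempty := by
  refine ⟨glue 0 (-1 / 2), mem_interior.2
    ⟨{p | ‖proj p‖ ^ 2 + p 3 ^ 2 < 1 ∧ ‖proj p‖ < 1 / 2 ∧ p 3 < 0}, ?_, ?_, ?_⟩⟩
  · rintro p ⟨h1, h2, h3⟩
    exact ⟨(mem_closedBall_iff_proj p).2 h1.le, h2.le, h3.le⟩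
  · exact (isOpen_lt continuous_norm_proj_sq_add continuous_const).inter <|
      (isOpen_lt continuous_proj.norm continuous_const).inter
        (isOpen_lt (continuous_coord 3) continuous_const)
  · norm_num [proj_glue, glue_last]

theorem interior_shell_nonempty : (interior shell).Nonempty := by
  refine ⟨glue (EuclideanSpace.single 0 (3 / 4)) 0, mem_interior.2
    ⟨{p | ‖proj p‖ ^ 2 + p 3 ^ 2 < 1 ∧ 1 / 2 < ‖proj p‖}, ?_, ?_, ?_⟩⟩
  · rintro p ⟨h1, h2⟩
    exact ⟨(mem_closedBall_iff_proj p).2 h1.le, h2.le⟩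
  · exact (isOpen_lt continuous_norm_proj_sq_add continuous_const).inter
      (isOpen_lt continuous_const continuous_proj.norm)
  · norm_num [proj_glue, glue_last]

theorem interior_profile_nonempty : (interior profile).Nonempty := by
  refine ⟨EuclideanSpace.single 0 (3 / 4), mem_interior.2
    ⟨{k | k 0 ^ 2 + k 1 ^ 2 < 1 ∧ 1 / 2 < k 0}, ?_, ?_, ?_⟩⟩
  · rintro k ⟨h1, h2⟩
    exact (mem_profile_iff k).2 ⟨h1.le, h2.le⟩
  · exact (isOpen_lt (((continuous_coord 0).pow 2).add ((continuous_coord 1).pow 2))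
      continuous_const).inter
      (isOpen_lt continuous_const (continuous_coord 0))
  · norm_num

theorem proj_ne_zero_of_mem_shell {p : EuclideanSpace ℝ (Fin 4)} (hp : p ∈ shell) :
    ‖proj p‖ ≠ 0 := by
  have := hp.2
  intro h
  norm_num [h] at this

/-- Cylindrical coordinates on the shell. -/
noncomputable def shellHomeomorph :
    shell ≃ₜ Metric.sphere (0 : EuclideanSpace ℝ (Fin 3)) 1 × profile where
  toFun p := (⟨‖proj p‖⁻¹ • proj p, by
      simp [norm_smul, inv_mul_cancel₀ (proj_ne_zero_of_mem_shell p.2)]⟩,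
    ⟨!₂[‖proj p‖, p.1 3], (mem_profile_iff _).2 <| by
      simpa using And.intro ((mem_closedBall_iff_proj _).1 p.2.1) p.2.2⟩)
  invFun q := ⟨glue (q.2.1 0 • q.1.1) (q.2.1 1), by
    obtain ⟨⟨x, hx⟩, ⟨k, hk⟩⟩ := q
    rw [mem_profile_iff] at hk
    rw [mem_sphere_zero_iff_norm] at hx
    have h0 : |k 0| = k 0 := abs_of_nonneg (by linarith [hk.2])
    rw [shell, Set.mem_ofPred_eq, mem_closedBall_iff_proj]
    simpa [proj_glue, glue_last, norm_smul, hx, h0] using hk⟩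
  left_inv p := by
    ext1
    simp [smul_smul, mul_inv_cancel₀ (proj_ne_zero_of_mem_shell p.2), glue_proj]
  right_inv q := by
    obtain ⟨⟨x, hx⟩, ⟨k, hk⟩⟩ := q
    rw [mem_profile_iff] at hk
    rw [mem_sphere_zero_iff_norm] at hx
    have h0 : |k 0| = k 0 := abs_of_nonneg (by linarith [hk.2])
    have h1 : k 0 ≠ 0 := by linarith [hk.2]
    refine Prod.ext (Subtype.ext ?_) (Subtype.ext ?_)
    · simp [proj_glue, norm_smul, hx, h0, smul_smul, h1]
    · ext i
      fin_cases i <;> simp [proj_glue, glue_last, norm_smul, hx, h0]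
  continuous_toFun := by
    have hc : Continuous fun p : shell => proj p := continuous_proj.comp continuous_subtype_val
    refine Continuous.prodMk (Continuous.subtype_mk ?_ _) (Continuous.subtype_mk ?_ _)
    · exact (hc.norm.inv₀ fun p => proj_ne_zero_of_mem_shell p.2).smul hc
    · refine (PiLp.continuous_toLp 2 _).comp (continuous_pi fun i => ?_)
      fin_cases i <;> simp <;> fun_prop
  continuous_invFun := by
    refine Continuous.subtype_mk (continuous_glue.comp (Continuous.prodMk ?_ ?_)) _ <;> fun_prop

theorem isConnected_shell : IsConnected shell := by
  have : ConnectedSpace (Metric.sphere (0 : EuclideanSpace ℝ (Fin 3)) 1) :=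
    isConnected_iff_connectedSpace.1 <| isConnected_sphere
      (by rw [← Module.finrank_eq_rank, finrank_euclideanSpace_fin]; norm_num) 0 zero_le_one
  have : ConnectedSpace profile := isConnected_iff_connectedSpace.1
    (convex_profile.isConnected (interior_profile_nonempty.mono interior_subset))
  exact isConnected_iff_connectedSpace.2
    (shellHomeomorph.symm.surjective.connectedSpace shellHomeomorph.symm.continuous)

theorem interior_upperCore_inter_lowerCore : interior (upperCore ∩ lowerCore) = ∅ := by
  refine interior_eq_empty_of_forall_add_smul_notMem (fun _ => glue 0 1) ?_
  rintro p ⟨h1, -⟩ ε hε ⟨-, h2⟩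
  have h3 := h1.2.2
  have h4 := h2.2.2
  simp [glue_last] at h4
  linarith

theorem interior_norm_proj_eq : interior {p | ‖proj p‖ = 1 / 2} = ∅ := by
  refine interior_eq_empty_of_forall_add_smul_notMem id fun p hp ε hε h => ?_
  have h1 : p + ε • id p = (1 + ε) • p := by rw [id, add_smul, one_smul]
  have h2 : |1 + ε| = 1 + ε := abs_of_pos (by linarith)
  rw [Set.mem_ofPred_eq] at hp h
  rw [h1, map_smul, norm_smul, hp, Real.norm_eq_abs, h2] at h
  linarith

theorem interior_upperCore_inter_shell : interior (upperCore ∩ shell) = ∅ :=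
  Set.subset_eq_empty (interior_mono fun _ h => le_antisymm h.1.2.1 h.2.2) interior_norm_proj_eq

theorem interior_lowerCore_inter_shell : interior (lowerCore ∩ shell) = ∅ :=
  Set.subset_eq_empty (interior_mono fun _ h => le_antisymm h.1.2.1 h.2.2) interior_norm_proj_eq

theorem upperCore_union_lowerCore_union_shell :
    upperCore ∪ lowerCore ∪ shell = Metric.closedBall (0 : EuclideanSpace ℝ (Fin 4)) 1 := by
  ext p
  have h1 := le_total ‖proj p‖ (1 / 2)
  have h2 := le_total (p 3) 0
  simp only [upperCore, lowerCore, shell, Set.mem_union, Set.mem_ofPred_eq]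
  tauto

end FourBall

/-- **Complement Covering Theorem (sphere case).** The closed unit ball `B⁴ ⊆ ℝ⁴` is the
union of three compact connected subsets with pairwise disjoint nonempty interiors, two
of which are homeomorphic to the closed unit 4-ball and the third to `S² × D²`. -/
theorem unitBall4_three_piece_decomposition_sphere :
    ∃ T : Fin 3 → Set (EuclideanSpace ℝ (Fin 4)),
      (⋃ i, T i) = Metric.closedBall (0 : EuclideanSpace ℝ (Fin 4)) 1 ∧
      (∀ i, IsCompact (T i)) ∧
      (∀ i, IsConnected (T i)) ∧
      (∀ i, (interior (T i)).Nonempty) ∧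
      (∀ i j, i ≠ j → interior (T i) ∩ interior (T j) = ∅) ∧
      Nonempty ((T 0) ≃ₜ Metric.closedBall (0 : EuclideanSpace ℝ (Fin 4)) 1) ∧
      Nonempty ((T 1) ≃ₜ Metric.closedBall (0 : EuclideanSpace ℝ (Fin 4)) 1) ∧
      Nonempty ((T 2) ≃ₜ
        (Metric.sphere (0 : EuclideanSpace ℝ (Fin 3)) 1 ×
          Metric.closedBall (0 : EuclideanSpace ℝ (Fin 2)) 1)) := by
  have hu : IsCompact FourBall.upperCore :=
    (isCompact_closedBall 0 1).of_isClosed_subset FourBall.isClosed_upperCore fun _ h => h.1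
  have hl : IsCompact FourBall.lowerCore :=
    (isCompact_closedBall 0 1).of_isClosed_subset FourBall.isClosed_lowerCore fun _ h => h.1
  have hs : IsCompact FourBall.shell :=
    (isCompact_closedBall 0 1).of_isClosed_subset FourBall.isClosed_shell fun _ h => h.1
  have hp : IsCompact FourBall.profile :=
    (isCompact_closedBall 0 1).of_isClosed_subset FourBall.isClosed_profile fun _ h => h.1
  have hul := FourBall.interior_upperCore_inter_lowerCore
  have hus := FourBall.interior_upperCore_inter_shell
  have hls := FourBall.interior_lowerCore_inter_shell
  rw [interior_inter] at hul hus hls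
  refine ⟨![FourBall.upperCore, FourBall.lowerCore, FourBall.shell], ?_, ?_, ?_, ?_, ?_,
    FourBall.convex_upperCore.nonempty_homeomorph_closedBall hu
      FourBall.interior_upperCore_nonempty,
    FourBall.convex_lowerCore.nonempty_homeomorph_closedBall hl
      FourBall.interior_lowerCore_nonempty, ?_⟩
  · rw [← FourBall.upperCore_union_lowerCore_union_shell]
    ext p
    simp [Fin.exists_fin_succ, or_assoc]
  · simp [Fin.forall_fin_succ, hu, hl, hs]
  · simp [Fin.forall_fin_succ, FourBall.isConnected_shell,
      FourBall.convex_upperCore.isConnected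
        (FourBall.interior_upperCore_nonempty.mono interior_subset),
      FourBall.convex_lowerCore.isConnected
        (FourBall.interior_lowerCore_nonempty.mono interior_subset)]
  · simp [Fin.forall_fin_succ, FourBall.interior_upperCore_nonempty,
      FourBall.interior_lowerCore_nonempty, FourBall.interior_shell_nonempty]
  · intro i j hij
    fin_cases i <;> fin_cases j <;>
      first
      | exact absurd rfl hij
      | assumption
      | (rw [Set.inter_comm]; assumption)
  · obtain ⟨e⟩ := FourBall.convex_profile.nonempty_homeomorph_closedBall hp
      FourBall.interior_profile_nonempty
    exact ⟨FourBall.shellHomeomorph.trans ((Homeomorph.refl _).prodCongr e)⟩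
end

section
/- The closed unit ball B⁴ = {x ∈ ℝ⁴ : ‖x‖ ≤ 1} can be written as the union of three compact, connected subsets with pairwise disjoint, nonempty interiors, such that two of the subsets are homeomorphic (with their subspace topologies) to the closed unit ball in ℝ⁴, and the third is homeomorphic to (S¹ × S¹) × D², where S¹ = {v ∈ ℝ² : ‖v‖ = 1} and D² = {v ∈ ℝ² : ‖v‖ ≤ 1}. (This is the Complement Covering Theorem in the case where the surface F is a torus, recorded up to homeomorphism type of the pieces.) -/
/-- The distance from the first three coordinates of a point of `ℝ⁴` to the circle of radius `1/2`
in the plane of the first two coordinates. -/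
noncomputable def circleDist (p : EuclideanSpace ℝ (Fin 4)) : ℝ :=
  √((√(p 0 ^ 2 + p 1 ^ 2) - 1 / 2) ^ 2 + p 2 ^ 2)

/-- The closed tube of radius `1/10` around the torus `circleDist = 1/5`, `p 3 = 0`. -/
def torusTube : Set (EuclideanSpace ℝ (Fin 4)) :=
  {p | (circleDist p - 1 / 5) ^ 2 + p 3 ^ 2 ≤ 1 / 100}

/-- The height of `torusTube` in the direction of the last coordinate
(zero away from the tube). -/
noncomputable def tubeHeight (p : EuclideanSpace ℝ (Fin 4)) : ℝ :=
  √(1 / 100 - (circleDist p - 1 / 5) ^ 2)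

/-- The part of the closed unit ball lying below `torusTube`. -/
def lowerPiece : Set (EuclideanSpace ℝ (Fin 4)) :=
  {p | p ∈ Metric.closedBall 0 1 ∧ p 3 ≤ -tubeHeight p}

/-- The part of the closed unit ball with nonpositive last coordinate. -/
def lowerHalfBall : Set (EuclideanSpace ℝ (Fin 4)) :=
  {p | p ∈ Metric.closedBall 0 1 ∧ p 3 ≤ 0}

/-- Translation in the direction of the last coordinate. -/
noncomputable def addLast (p : EuclideanSpace ℝ (Fin 4)) (c : ℝ) : EuclideanSpace ℝ (Fin 4) :=
  !₂[p 0, p 1, p 2, p 3 + c]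

theorem continuous_circleDist : Continuous circleDist := by
  unfold circleDist; fun_prop

theorem continuous_tubeHeight : Continuous tubeHeight := by
  have := continuous_circleDist
  unfold tubeHeight; fun_prop

theorem tubeHeight_nonneg (p : EuclideanSpace ℝ (Fin 4)) : 0 ≤ tubeHeight p :=
  Real.sqrt_nonneg _

theorem tubeHeight_le (p : EuclideanSpace ℝ (Fin 4)) : tubeHeight p ≤ 1 / 10 := by
  unfold tubeHeight
  rw [Real.sqrt_le_left (by norm_num)]
  nlinarith [sq_nonneg (circleDist p - 1 / 5)]

theorem circleDist_neg (p : EuclideanSpace ℝ (Fin 4)) : circleDist (-p) = circleDist p := by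
  simp [circleDist]

theorem tubeHeight_neg (p : EuclideanSpace ℝ (Fin 4)) : tubeHeight (-p) = tubeHeight p := by
  simp [tubeHeight, circleDist_neg]

theorem tubeHeight_addLast (p : EuclideanSpace ℝ (Fin 4)) (c : ℝ) :
    tubeHeight (addLast p c) = tubeHeight p := by
  simp [tubeHeight, circleDist, addLast]

theorem addLast_apply_last (p : EuclideanSpace ℝ (Fin 4)) (c : ℝ) :
    addLast p c 3 = p 3 + c := by
  simp [addLast]

theorem addLast_addLast (p : EuclideanSpace ℝ (Fin 4)) (c d : ℝ) :
    addLast (addLast p c) d = addLast p (c + d) := by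
  ext i; fin_cases i <;> simp [addLast, add_assoc]

theorem addLast_zero (p : EuclideanSpace ℝ (Fin 4)) : addLast p 0 = p := by
  ext i; fin_cases i <;> simp [addLast]

theorem continuous_addLast {X : Type*} [TopologicalSpace X]
    {f : X → EuclideanSpace ℝ (Fin 4)} {c : X → ℝ} (hf : Continuous f) (hc : Continuous c) :
    Continuous fun x => addLast (f x) (c x) := by
  unfold addLast
  refine (PiLp.continuous_toLp 2 _).comp (continuous_pi fun i => ?_)
  fin_cases i <;> simp <;> fun_prop

theorem mem_unitClosedBall_iff (p : EuclideanSpace ℝ (Fin 4)) :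
    p ∈ Metric.closedBall (0 : EuclideanSpace ℝ (Fin 4)) 1 ↔
      p 0 ^ 2 + p 1 ^ 2 + p 2 ^ 2 + p 3 ^ 2 ≤ 1 := by
  rw [mem_closedBall_zero_iff, EuclideanSpace.norm_eq, Real.sqrt_le_left zero_le_one]
  simp [Fin.sum_univ_four]

theorem sq_add_sq_add_sq_le_of_circleDist_near {p : EuclideanSpace ℝ (Fin 4)}
    (h : (circleDist p - 1 / 5) ^ 2 ≤ 1 / 100) :
    p 0 ^ 2 + p 1 ^ 2 + p 2 ^ 2 ≤ 16 / 25 := by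
  have h0 : 0 ≤ circleDist p := Real.sqrt_nonneg _
  have h1 : circleDist p ≤ 3 / 10 := by nlinarith
  have h2 : circleDist p ^ 2 = (√(p 0 ^ 2 + p 1 ^ 2) - 1 / 2) ^ 2 + p 2 ^ 2 :=
    Real.sq_sqrt (by positivity)
  have h3 : √(p 0 ^ 2 + p 1 ^ 2) ^ 2 = p 0 ^ 2 + p 1 ^ 2 := Real.sq_sqrt (by positivity)
  have h4 : √(p 0 ^ 2 + p 1 ^ 2) ≤ 4 / 5 := by nlinarith [sq_nonneg (p 2)]
  nlinarith

theorem sq_add_sq_add_sq_le_of_tubeHeight_ne_zero {p : EuclideanSpace ℝ (Fin 4)}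
    (h : tubeHeight p ≠ 0) : p 0 ^ 2 + p 1 ^ 2 + p 2 ^ 2 ≤ 16 / 25 := by
  refine sq_add_sq_add_sq_le_of_circleDist_near ?_
  by_contra! h'
  exact h (Real.sqrt_eq_zero_of_nonpos (by linarith))

/-- For `0 ≤ g < 1/5`, the piecewise linear homeomorphism of the line that fixes `t ≤ -1/5`
and takes `-g` to `0`. -/
noncomputable def raise (g t : ℝ) : ℝ := max t ((t + g) / (1 - 5 * g))

/-- The inverse of `raise g`. -/
noncomputable def unraise (g t : ℝ) : ℝ := min t (t * (1 - 5 * g) - g)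

theorem unraise_raise {g : ℝ} (h0 : 0 ≤ g) (h1 : g ≤ 1 / 10) (t : ℝ) :
    unraise g (raise g t) = t := by
  have hp : 0 < 1 - 5 * g := by linarith
  unfold raise unraise
  rcases le_total t (-1 / 5) with h | h
  · rw [max_eq_left (by rw [div_le_iff₀ hp]; nlinarith), min_eq_left (by nlinarith)]
  · have h2 : t ≤ (t + g) / (1 - 5 * g) := by rw [le_div_iff₀ hp]; nlinarith
    rw [max_eq_right h2, div_mul_cancel₀ _ hp.ne', min_eq_right (by linarith)]
    ring

theorem raise_unraise {g : ℝ} (h0 : 0 ≤ g) (h1 : g ≤ 1 / 10) (t : ℝ) :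
    raise g (unraise g t) = t := by
  have hp : 0 < 1 - 5 * g := by linarith
  unfold raise unraise
  rcases le_total t (-1 / 5) with h | h
  · rw [min_eq_left (by nlinarith), max_eq_left (by rw [div_le_iff₀ hp]; nlinarith)]
  · rw [min_eq_right (by nlinarith), sub_add_cancel, mul_div_cancel_right₀ _ hp.ne',
      max_eq_right (by nlinarith)]

theorem raise_nonpos_iff {g : ℝ} (h0 : 0 ≤ g) (h1 : g ≤ 1 / 10) (t : ℝ) :
    raise g t ≤ 0 ↔ t ≤ -g := by
  have hp : 0 < 1 - 5 * g := by linarith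
  rw [raise, max_le_iff, div_le_iff₀ hp]
  constructor
  · rintro ⟨_, h⟩; linarith
  · intro h; constructor <;> linarith

theorem raise_of_le {g t : ℝ} (h0 : 0 ≤ g) (h1 : g ≤ 1 / 10) (h : t ≤ -1 / 5) :
    raise g t = t := by
  have hp : 0 < 1 - 5 * g := by linarith
  exact max_eq_left (by rw [div_le_iff₀ hp]; nlinarith)

/-- The homeomorphism of `ℝ⁴` pushing `lowerPiece` onto `lowerHalfBall`. -/
noncomputable def raiseHomeomorph :
    EuclideanSpace ℝ (Fin 4) ≃ₜ EuclideanSpace ℝ (Fin 4) where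
  toFun p := addLast p (raise (tubeHeight p) (p 3) - p 3)
  invFun p := addLast p (unraise (tubeHeight p) (p 3) - p 3)
  left_inv p := by
    simp only [tubeHeight_addLast, addLast_apply_last, addLast_addLast, add_sub_cancel,
      unraise_raise (tubeHeight_nonneg p) (tubeHeight_le p)]
    convert addLast_zero p using 2
    ring
  right_inv p := by
    simp only [tubeHeight_addLast, addLast_apply_last, addLast_addLast, add_sub_cancel,
      raise_unraise (tubeHeight_nonneg p) (tubeHeight_le p)]
    convert addLast_zero p using 2
    ring
  continuous_toFun := by
    have hg := continuous_tubeHeight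
    refine continuous_addLast continuous_id (Continuous.sub ?_ (by fun_prop))
    refine Continuous.max (by fun_prop) (Continuous.div (by fun_prop) (by fun_prop) fun p => ?_)
    have := tubeHeight_le p
    linarith
  continuous_invFun := by
    have hg := continuous_tubeHeight
    refine continuous_addLast continuous_id (Continuous.sub ?_ (by fun_prop))
    exact Continuous.min (by fun_prop) (by fun_prop)

theorem raiseHomeomorph_preimage : raiseHomeomorph ⁻¹' lowerHalfBall = lowerPiece := by
  ext p
  have h0 := tubeHeight_nonneg p
  have h1 := tubeHeight_le p
  have hlast : raiseHomeomorph p 3 = raise (tubeHeight p) (p 3) := by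
    simp [raiseHomeomorph, addLast_apply_last]
  have hball : raiseHomeomorph p ∈ Metric.closedBall (0 : EuclideanSpace ℝ (Fin 4)) 1 ↔
      p 0 ^ 2 + p 1 ^ 2 + p 2 ^ 2 + raise (tubeHeight p) (p 3) ^ 2 ≤ 1 := by
    rw [mem_unitClosedBall_iff, hlast]
    simp [raiseHomeomorph, addLast]
  simp only [Set.mem_preimage, lowerHalfBall, lowerPiece, Set.mem_ofPred_eq, hlast, hball,
    raise_nonpos_iff h0 h1]
  refine and_congr_left fun h => ?_
  rw [mem_unitClosedBall_iff]
  by_cases hg : tubeHeight p = 0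
  · simp [hg, raise]
  · have hx := sq_add_sq_add_sq_le_of_tubeHeight_ne_zero hg
    rcases le_total (p 3) (-1 / 5) with ht | ht
    · rw [raise_of_le h0 h1 ht]
    · have h2 := (raise_nonpos_iff h0 h1 _).2 h
      have h3 : p 3 ≤ raise (tubeHeight p) (p 3) := le_max_left _ _
      constructor <;> intro <;> nlinarith

theorem convex_lowerHalfBall : Convex ℝ lowerHalfBall := by
  refine (convex_closedBall _ _).inter ?_
  exact convex_halfSpace_le (f := fun p : EuclideanSpace ℝ (Fin 4) => p 3)
    ⟨fun _ _ => rfl, fun _ _ => rfl⟩ 0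

theorem isCompact_lowerHalfBall : IsCompact lowerHalfBall :=
  (isCompact_closedBall _ _).inter_right
    (isClosed_le (f := fun p : EuclideanSpace ℝ (Fin 4) => p 3) (by fun_prop) continuous_const)

theorem interior_lowerHalfBall_nonempty : (interior lowerHalfBall).Nonempty := by
  refine ⟨!₂[0, 0, 0, -1 / 2], ?_⟩
  refine mem_interior.2 ⟨Metric.ball 0 1 ∩ {p | p 3 < 0}, ?_, ?_, ?_⟩
  · rintro p ⟨h, h'⟩
    exact ⟨Metric.ball_subset_closedBall h, le_of_lt h'⟩
  · exact Metric.isOpen_ball.inter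
      (isOpen_lt (f := fun p : EuclideanSpace ℝ (Fin 4) => p 3) (by fun_prop) continuous_const)
  · constructor
    · rw [mem_ball_zero_iff, EuclideanSpace.norm_eq, Real.sqrt_lt' one_pos]
      simp [Fin.sum_univ_four]
      norm_num
    · simp
      norm_num

theorem exists_homeomorph_lowerPiece :
    ∃ h : EuclideanSpace ℝ (Fin 4) ≃ₜ EuclideanSpace ℝ (Fin 4),
      h '' Metric.closedBall 0 1 = lowerPiece := by
  obtain ⟨h, -, hc, -⟩ := exists_homeomorph_image_interior_closure_frontier_eq_unitBall
    convex_lowerHalfBall interior_lowerHalfBall_nonempty isCompact_lowerHalfBall.isBounded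
  rw [isCompact_lowerHalfBall.isClosed.closure_eq] at hc
  refine ⟨(raiseHomeomorph.trans h).symm, ?_⟩
  rw [← raiseHomeomorph_preimage, Homeomorph.image_symm, ← hc]
  ext p
  simp

theorem interior_eq_empty_of_subset_graph {s : Set (EuclideanSpace ℝ (Fin 4))}
    {f : EuclideanSpace ℝ (Fin 4) → ℝ} (hf : ∀ p c, f (addLast p c) = f p)
    (hs : ∀ p ∈ s, p 3 = f p) : interior s = ∅ := by
  by_contra! hne
  obtain ⟨p, hp⟩ := hne
  have hcont : Continuous fun c : ℝ => addLast p c :=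
    continuous_addLast continuous_const continuous_id
  have hmem : ∀ᶠ c in nhds (0 : ℝ), addLast p c ∈ interior s :=
    hcont.continuousAt.eventually_mem (isOpen_interior.mem_nhds (by rwa [addLast_zero]))
  obtain ⟨c, hc, hc0⟩ :=
    ((hmem.filter_mono nhdsWithin_le_nhds).and (self_mem_nhdsWithin (s := {0}ᶜ))).exists
  have h1 := hs _ (interior_subset hc)
  have h2 := hs _ (interior_subset hp)
  rw [hf, addLast_apply_last] at h1
  exact hc0 (show c = 0 by linarith)

theorem abs_le_tubeHeight_of_mem_torusTube {p : EuclideanSpace ℝ (Fin 4)} (hp : p ∈ torusTube) :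
    |p 3| ≤ tubeHeight p :=
  Real.abs_le_sqrt (by simp only [torusTube, Set.mem_ofPred_eq] at hp; linarith)

theorem mem_torusTube_of_abs_lt {p : EuclideanSpace ℝ (Fin 4)} (hp : |p 3| < tubeHeight p) :
    p ∈ torusTube := by
  have := Real.lt_sqrt (abs_nonneg _) |>.1 hp
  rw [sq_abs] at this
  simp only [torusTube, Set.mem_ofPred_eq]
  linarith

theorem torusTube_subset_closedBall :
    torusTube ⊆ Metric.closedBall (0 : EuclideanSpace ℝ (Fin 4)) 1 := by
  intro p hp
  simp only [torusTube, Set.mem_ofPred_eq] at hp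
  rw [mem_unitClosedBall_iff]
  have := sq_add_sq_add_sq_le_of_circleDist_near (p := p) (by nlinarith [sq_nonneg (p 3)])
  nlinarith [sq_nonneg (circleDist p - 1 / 5)]

theorem interior_torusTube_nonempty : (interior torusTube).Nonempty := by
  refine ⟨!₂[7 / 10, 0, 0, 0], ?_⟩
  refine mem_interior.2 ⟨{p | (circleDist p - 1 / 5) ^ 2 + p 3 ^ 2 < 1 / 100}, ?_, ?_, ?_⟩
  · intro p hp
    simp only [torusTube, Set.mem_ofPred_eq] at hp ⊢
    exact hp.le
  · have := continuous_circleDist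
    exact isOpen_lt (by fun_prop) continuous_const
  · have : circleDist !₂[7 / 10, 0, 0, 0] = 1 / 5 := by
      simp only [circleDist]
      simp
      norm_num
    simp [this]

/-- The parametrization of `torusTube` by `(S¹ × S¹) × D²`. -/
noncomputable def tubeParam
    (q : (Metric.sphere (0 : EuclideanSpace ℝ (Fin 2)) 1 ×
          Metric.sphere (0 : EuclideanSpace ℝ (Fin 2)) 1) ×
          Metric.closedBall (0 : EuclideanSpace ℝ (Fin 2)) 1) : EuclideanSpace ℝ (Fin 4) :=
  !₂[(1 / 2 + (1 / 5 + q.2.1 0 / 10) * q.1.2.1 0) * q.1.1.1 0,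
    (1 / 2 + (1 / 5 + q.2.1 0 / 10) * q.1.2.1 0) * q.1.1.1 1,
    (1 / 5 + q.2.1 0 / 10) * q.1.2.1 1, q.2.1 1 / 10]

theorem continuous_tubeParam : Continuous tubeParam := by
  unfold tubeParam
  refine (PiLp.continuous_toLp 2 _).comp (continuous_pi fun i => ?_)
  fin_cases i <;> simp <;> fun_prop

theorem mem_unitCircle_iff (v : EuclideanSpace ℝ (Fin 2)) :
    v ∈ Metric.sphere (0 : EuclideanSpace ℝ (Fin 2)) 1 ↔ v 0 ^ 2 + v 1 ^ 2 = 1 := by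
  rw [mem_sphere_zero_iff_norm, EuclideanSpace.norm_eq, Real.sqrt_eq_one]
  simp [Fin.sum_univ_two]

theorem mem_unitDisc_iff (v : EuclideanSpace ℝ (Fin 2)) :
    v ∈ Metric.closedBall (0 : EuclideanSpace ℝ (Fin 2)) 1 ↔ v 0 ^ 2 + v 1 ^ 2 ≤ 1 := by
  rw [mem_closedBall_zero_iff, EuclideanSpace.norm_eq, Real.sqrt_le_left zero_le_one]
  simp [Fin.sum_univ_two]

theorem sqrt_tubeParam (q) :
    √(tubeParam q 0 ^ 2 + tubeParam q 1 ^ 2) =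
      1 / 2 + (1 / 5 + q.2.1 0 / 10) * q.1.2.1 0 := by
  obtain ⟨⟨⟨u, hu⟩, v, hv⟩, w, hw⟩ := q
  rw [mem_unitCircle_iff] at hu hv
  rw [mem_unitDisc_iff] at hw
  rw [← Real.sqrt_sq (x := 1 / 2 + _)]
  · congr 1
    simp only [tubeParam]
    simp
    linear_combination (1 / 2 + (1 / 5 + w 0 / 10) * v 0) ^ 2 * hu
  · have hw1 : |w 0| ≤ 1 := abs_le_one_iff_mul_self_le_one.2 (by nlinarith [sq_nonneg (w 1)])
    have hv1 : |v 0| ≤ 1 := abs_le_one_iff_mul_self_le_one.2 (by nlinarith [sq_nonneg (v 1)])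
    rw [abs_le] at hw1 hv1
    change 0 ≤ 1 / 2 + (1 / 5 + w 0 / 10) * v 0
    nlinarith

theorem abs_apply_zero_le_one (w : Metric.closedBall (0 : EuclideanSpace ℝ (Fin 2)) 1) :
    |w.1 0| ≤ 1 := by
  have hw := (mem_unitDisc_iff _).1 w.2
  exact abs_le_one_iff_mul_self_le_one.2 (by nlinarith [sq_nonneg (w.1 1)])

theorem circleDist_tubeParam (q) : circleDist (tubeParam q) = 1 / 5 + q.2.1 0 / 10 := by
  have hw := abs_le.1 (abs_apply_zero_le_one q.2)
  have hv := (mem_unitCircle_iff _).1 q.1.2.2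
  rw [circleDist, sqrt_tubeParam]
  refine (congrArg Real.sqrt ?_).trans (Real.sqrt_sq (by linarith))
  simp only [tubeParam]
  simp
  linear_combination (1 / 5 + q.2.1 0 / 10) ^ 2 * hv

theorem injective_tubeParam : Function.Injective tubeParam := by
  intro q q' h
  have hd := circleDist_tubeParam q
  have hr := sqrt_tubeParam q
  rw [h, circleDist_tubeParam] at hd
  rw [h, sqrt_tubeParam] at hr
  have hw := abs_le.1 (abs_apply_zero_le_one q.2)
  have hv := (mem_unitCircle_iff _).1 q.1.2.2
  have e0 := congrArg (fun p => p 0) h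
  have e1 := congrArg (fun p => p 1) h
  have e2 := congrArg (fun p => p 2) h
  have e3 := congrArg (fun p => p 3) h
  simp only [tubeParam] at e0 e1 e2 e3
  simp at e0 e1 e2 e3
  obtain ⟨⟨⟨u, hu⟩, v, hv'⟩, w, hw'⟩ := q
  obtain ⟨⟨⟨u', hu'⟩, v', hv''⟩, w', hw''⟩ := q'
  simp only at *
  have hw0 : w' 0 = w 0 := by linarith
  rw [hw0] at hr e0 e1 e2
  have hpos : 1 / 5 + w 0 / 10 ≠ 0 := by linarith
  have hv0 : v' 0 = v 0 := mul_left_cancel₀ hpos (by linarith)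
  have hv1 : v 1 = v' 1 := mul_left_cancel₀ hpos (by simpa using e2)
  have hpos' : 1 / 2 + (1 / 5 + w 0 / 10) * v 0 ≠ 0 := by
    have hv1 : |v 0| ≤ 1 := abs_le_one_iff_mul_self_le_one.2 (by nlinarith [sq_nonneg (v 1)])
    rw [abs_le] at hv1
    nlinarith
  rw [hv0] at e0 e1
  have hu0 : u 0 = u' 0 := mul_left_cancel₀ hpos' (by simpa using e0)
  have hu1 : u 1 = u' 1 := mul_left_cancel₀ hpos' (by simpa using e1)
  have hU : u = u' := by ext i; fin_cases i <;> assumption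
  have hV : v = v' := by ext i; fin_cases i; exacts [hv0.symm, hv1]
  have hW : w = w' := by ext i; fin_cases i; exacts [hw0.symm, e3]
  subst hU hV hW
  rfl

theorem exists_unit_smul {x y r : ℝ} (hr : 0 < r) (h : r ^ 2 = x ^ 2 + y ^ 2) :
    ∃ u : Metric.sphere (0 : EuclideanSpace ℝ (Fin 2)) 1, r * u.1 0 = x ∧ r * u.1 1 = y := by
  refine ⟨⟨!₂[x / r, y / r], ?_⟩, ?_, ?_⟩
  · rw [mem_unitCircle_iff]
    simp
    field_simp
    exact h.symm
  · simp; field_simp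
  · simp; field_simp

theorem range_tubeParam : Set.range tubeParam = torusTube := by
  ext p
  constructor
  · rintro ⟨q, rfl⟩
    have hw := (mem_unitDisc_iff _).1 q.2.2
    have h3 : tubeParam q 3 = q.2.1 1 / 10 := by simp [tubeParam]
    simp only [torusTube, Set.mem_ofPred_eq, circleDist_tubeParam, h3]
    nlinarith
  · intro hp
    simp only [torusTube, Set.mem_ofPred_eq] at hp
    have hd : circleDist p ^ 2 = (√(p 0 ^ 2 + p 1 ^ 2) - 1 / 2) ^ 2 + p 2 ^ 2 :=
      Real.sq_sqrt (by positivity)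
    have hr : √(p 0 ^ 2 + p 1 ^ 2) ^ 2 = p 0 ^ 2 + p 1 ^ 2 := Real.sq_sqrt (by positivity)
    have hd0 : 0 < circleDist p := by nlinarith [sq_nonneg (p 3)]
    have hd1 : circleDist p ≤ 3 / 10 := by nlinarith [sq_nonneg (p 3)]
    have hr0 : 0 < √(p 0 ^ 2 + p 1 ^ 2) := by nlinarith [sq_nonneg (p 2)]
    obtain ⟨u, hu0, hu1⟩ := exists_unit_smul hr0 hr
    obtain ⟨v, hv0, hv1⟩ := exists_unit_smul hd0 hd
    refine ⟨((u, v), ⟨!₂[10 * (circleDist p - 1 / 5), 10 * p 3], ?_⟩), ?_⟩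
    · rw [mem_unitDisc_iff]
      simp
      nlinarith
    · have e : 1 / 5 + 10 * (circleDist p - 1 / 5) / 10 = circleDist p := by ring
      have e' : 1 / 2 + circleDist p * v.1 0 = √(p 0 ^ 2 + p 1 ^ 2) := by rw [hv0]; ring
      ext i
      simp only [tubeParam, PiLp.toLp_apply, Matrix.cons_val_zero, Matrix.cons_val_one, e, e']
      fin_cases i
      · exact hu0
      · exact hu1
      · exact hv1
      · simp

/-- **Complement Covering Theorem (torus case).** The closed unit ball `B⁴ ⊆ ℝ⁴` is the
union of three compact connected subsets with pairwise disjoint nonempty interiors, two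
of which are homeomorphic to the closed unit 4-ball and the third to `(S¹ × S¹) × D²`. -/
theorem unitBall4_three_piece_decomposition_torus :
    ∃ T : Fin 3 → Set (EuclideanSpace ℝ (Fin 4)),
      (⋃ i, T i) = Metric.closedBall (0 : EuclideanSpace ℝ (Fin 4)) 1 ∧
      (∀ i, IsCompact (T i)) ∧
      (∀ i, IsConnected (T i)) ∧
      (∀ i, (interior (T i)).Nonempty) ∧
      (∀ i j, i ≠ j → interior (T i) ∩ interior (T j) = ∅) ∧
      Nonempty ((T 0) ≃ₜ Metric.closedBall (0 : EuclideanSpace ℝ (Fin 4)) 1) ∧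
      Nonempty ((T 1) ≃ₜ Metric.closedBall (0 : EuclideanSpace ℝ (Fin 4)) 1) ∧
      Nonempty ((T 2) ≃ₜ
        ((Metric.sphere (0 : EuclideanSpace ℝ (Fin 2)) 1 ×
          Metric.sphere (0 : EuclideanSpace ℝ (Fin 2)) 1) ×
          Metric.closedBall (0 : EuclideanSpace ℝ (Fin 2)) 1)) := by
  obtain ⟨h, hh⟩ := exists_homeomorph_lowerPiece
  have hn : (h.trans (Homeomorph.neg _)) '' Metric.closedBall 0 1 = Neg.neg '' lowerPiece := by
    rw [← hh, Set.image_image]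
    rfl
  have hupper : ∀ p, p ∈ Neg.neg '' lowerPiece ↔
      p ∈ Metric.closedBall (0 : EuclideanSpace ℝ (Fin 4)) 1 ∧ tubeHeight p ≤ p 3 := by
    intro p
    rw [Set.image_neg_eq_neg, Set.mem_neg]
    simp [lowerPiece, tubeHeight_neg]
  have ball_image (e : EuclideanSpace ℝ (Fin 4) ≃ₜ EuclideanSpace ℝ (Fin 4)) :
      IsCompact (e '' Metric.closedBall 0 1) ∧ IsConnected (e '' Metric.closedBall 0 1) ∧
      (interior (e '' Metric.closedBall 0 1)).Nonempty := by
    refine ⟨(isCompact_closedBall _ _).image e.continuous, IsConnected.image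
      ⟨⟨0, by simp⟩, (convex_closedBall _ _).isPreconnected⟩ _ e.continuous.continuousOn, ?_⟩
    rw [← e.image_interior]
    refine Set.Nonempty.image _ ⟨0, ?_⟩
    exact Metric.ball_subset_interior_closedBall (by simp)
  obtain ⟨c0, n0, i0⟩ := ball_image h
  obtain ⟨c1, n1, i1⟩ := ball_image (h.trans (Homeomorph.neg _))
  rw [hh] at c0 n0 i0
  rw [hn] at c1 n1 i1
  have hS : IsConnected (Metric.sphere (0 : EuclideanSpace ℝ (Fin 2)) 1) :=
    isConnected_sphere (by simp [← Module.finrank_eq_rank]) 0 zero_le_one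
  have : ConnectedSpace (Metric.sphere (0 : EuclideanSpace ℝ (Fin 2)) 1) :=
    isConnected_iff_connectedSpace.1 hS
  have : ConnectedSpace (Metric.closedBall (0 : EuclideanSpace ℝ (Fin 2)) 1) :=
    isConnected_iff_connectedSpace.1 ⟨⟨0, by simp⟩, (convex_closedBall _ _).isPreconnected⟩
  have d01 : interior lowerPiece ∩ interior (Neg.neg '' lowerPiece) = ∅ := by
    rw [← interior_inter]
    refine interior_eq_empty_of_subset_graph tubeHeight_addLast ?_
    rintro p ⟨⟨_, hp⟩, hp'⟩
    have := ((hupper p).1 hp').2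
    linarith [tubeHeight_nonneg p]
  have d02 : interior lowerPiece ∩ interior torusTube = ∅ := by
    rw [← interior_inter]
    refine interior_eq_empty_of_subset_graph (f := fun p => -tubeHeight p)
      (fun p c => by rw [tubeHeight_addLast]) ?_
    rintro p ⟨⟨_, hp⟩, hp'⟩
    have := abs_le.1 (abs_le_tubeHeight_of_mem_torusTube hp')
    linarith
  have d12 : interior (Neg.neg '' lowerPiece) ∩ interior torusTube = ∅ := by
    rw [← interior_inter]
    refine interior_eq_empty_of_subset_graph tubeHeight_addLast ?_
    rintro p ⟨hp, hp'⟩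
    have := abs_le.1 (abs_le_tubeHeight_of_mem_torusTube hp')
    linarith [((hupper p).1 hp).2]
  refine ⟨![lowerPiece, Neg.neg '' lowerPiece, torusTube], ?_, ?_, ?_, ?_, ?_, ?_, ?_, ?_⟩
  · ext p
    simp only [Set.mem_iUnion, Fin.exists_fin_succ, Matrix.cons_val_zero, Matrix.cons_val_succ,
      IsEmpty.exists_iff, or_false, hupper]
    constructor
    · rintro (hp | hp | hp)
      · exact hp.1
      · exact hp.1
      · exact torusTube_subset_closedBall hp
    · intro hp
      rcases lt_or_ge |p 3| (tubeHeight p) with hlt | hge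
      · exact Or.inr (Or.inr (mem_torusTube_of_abs_lt hlt))
      · rcases le_abs.1 hge with hge | hge
        · exact Or.inr (Or.inl ⟨hp, hge⟩)
        · exact Or.inl ⟨hp, by linarith⟩
  · intro i
    fin_cases i
    · exact c0
    · exact c1
    · change IsCompact torusTube
      rw [← range_tubeParam]
      exact isCompact_range continuous_tubeParam
  · intro i
    fin_cases i
    · exact n0
    · exact n1
    · change IsConnected torusTube
      rw [← range_tubeParam]
      exact isConnected_range continuous_tubeParam
  · intro i
    fin_cases i
    · exact i0
    · exact i1
    · exact interior_torusTube_nonempty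
  · intro i j hij
    fin_cases i <;> fin_cases j
    · exact absurd rfl hij
    · exact d01
    · exact d02
    · exact (Set.inter_comm _ _).trans d01
    · exact absurd rfl hij
    · exact d12
    · exact (Set.inter_comm _ _).trans d02
    · exact (Set.inter_comm _ _).trans d12
    · exact absurd rfl hij
  · exact ⟨((h.image _).trans (Homeomorph.setCongr hh)).symm⟩
  · exact ⟨(((h.trans (Homeomorph.neg _)).image _).trans (Homeomorph.setCongr hn)).symm⟩
  · exact ⟨((continuous_tubeParam.isClosedEmbedding injective_tubeParam).isEmbedding.toHomeomorph.trans
      (Homeomorph.setCongr range_tubeParam)).symm⟩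
end

section
/- The unit hypercube [0,1]⁴ ⊆ ℝ⁴ can be written as the union of three compact, connected subsets with pairwise disjoint, nonempty interiors, such that two of the subsets are homeomorphic (with their subspace topologies) to the closed unit ball in ℝ⁴, and the third is homeomorphic to S² × D², where S² = {v ∈ ℝ³ : ‖v‖ = 1} and D² = {v ∈ ℝ² : ‖v‖ ≤ 1}. (This instantiates the Complement Covering Theorem, which holds for any embedded 4-ball with corners, at the hypercube with F a 2-sphere, recorded up to homeomorphism type of the pieces.) -/
open Set Metric

/-- The closed coordinate box in Euclidean space with opposite corners `a` and `b`. -/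
def euclideanBox {n : ℕ} (a b : Fin n → ℝ) : Set (EuclideanSpace ℝ (Fin n)) :=
  {x | ∀ k, x k ∈ Icc (a k) (b k)}

theorem euclideanBox_eq_preimage {n : ℕ} (a b : Fin n → ℝ) :
    euclideanBox a b =
      (EuclideanSpace.equiv (Fin n) ℝ).toHomeomorph ⁻¹' (univ.pi fun k => Icc (a k) (b k)) := by
  ext x
  simp [euclideanBox, Pi.le_def, forall_and]

theorem interior_euclideanBox {n : ℕ} (a b : Fin n → ℝ) :
    interior (euclideanBox a b) = {x | ∀ k, x k ∈ Ioo (a k) (b k)} := by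
  rw [euclideanBox_eq_preimage, ← Homeomorph.preimage_interior, interior_pi_set finite_univ]
  ext x
  simp [mem_pi]

theorem isCompact_euclideanBox {n : ℕ} (a b : Fin n → ℝ) : IsCompact (euclideanBox a b) := by
  rw [euclideanBox_eq_preimage, Homeomorph.isCompact_preimage]
  exact isCompact_univ_pi fun k => isCompact_Icc

theorem convex_euclideanBox {n : ℕ} (a b : Fin n → ℝ) : Convex ℝ (euclideanBox a b) := by
  rw [euclideanBox_eq_preimage]
  exact (convex_pi fun k _ => convex_Icc (a k) (b k)).linear_preimage
    (EuclideanSpace.equiv (Fin n) ℝ).toLinearEquiv.toLinearMap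

theorem nonempty_interior_euclideanBox {n : ℕ} {a b : Fin n → ℝ} (h : ∀ k, a k < b k) :
    (interior (euclideanBox a b)).Nonempty := by
  rw [interior_euclideanBox]
  exact ⟨WithLp.toLp 2 fun k => (a k + b k) / 2, fun k => by
    have := h k
    constructor <;> simp <;> linarith⟩

theorem isConnected_euclideanBox {n : ℕ} {a b : Fin n → ℝ} (h : ∀ k, a k < b k) :
    IsConnected (euclideanBox a b) :=
  (convex_euclideanBox a b).isConnected ((nonempty_interior_euclideanBox h).mono interior_subset)

theorem nonempty_homeomorph_euclideanBox_closedBall {n : ℕ} {a b : Fin n → ℝ}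
    (h : ∀ k, a k < b k) :
    Nonempty (euclideanBox a b ≃ₜ closedBall (0 : EuclideanSpace ℝ (Fin n)) 1) := by
  obtain ⟨e, -, he, -⟩ := exists_homeomorph_image_interior_closure_frontier_eq_unitBall
    (convex_euclideanBox a b) (nonempty_interior_euclideanBox h)
    (isCompact_euclideanBox a b).isBounded
  rw [(isCompact_euclideanBox a b).isClosed.closure_eq] at he
  exact ⟨(e.image _).trans (Homeomorph.setCongr he)⟩

/-- The first three coordinates of a point of `ℝ⁴`, relative to the centre of the unit cube. -/
noncomputable def centeredCoords (x : EuclideanSpace ℝ (Fin 4)) : EuclideanSpace ℝ (Fin 3) :=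
  !₂[x 0 - 1 / 2, x 1 - 1 / 2, x 2 - 1 / 2]

theorem continuous_centeredCoords : Continuous centeredCoords := by
  unfold centeredCoords
  refine (PiLp.continuous_toLp 2 _).comp (continuous_pi fun i => ?_)
  fin_cases i <;> simp <;> fun_prop

theorem norm_centeredCoords_le_iff {x : EuclideanSpace ℝ (Fin 4)} {r : ℝ} (hr : 0 ≤ r) :
    ‖(centeredCoords x).ofLp‖ ≤ r ↔
      |x 0 - 1 / 2| ≤ r ∧ |x 1 - 1 / 2| ≤ r ∧ |x 2 - 1 / 2| ≤ r := by
  simp [pi_norm_le_iff_of_nonneg hr, Fin.forall_fin_succ, centeredCoords]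

theorem norm_centeredCoords_lt_iff {x : EuclideanSpace ℝ (Fin 4)} {r : ℝ} (hr : 0 < r) :
    ‖(centeredCoords x).ofLp‖ < r ↔
      |x 0 - 1 / 2| < r ∧ |x 1 - 1 / 2| < r ∧ |x 2 - 1 / 2| < r := by
  simp [pi_norm_lt_iff hr, Fin.forall_fin_succ, centeredCoords]

/-- A closed cubical shell of dimension three times the unit interval. -/
def thickShell : Set (EuclideanSpace ℝ (Fin 4)) :=
  {x | ‖(centeredCoords x).ofLp‖ ∈ Icc (1 / 4 : ℝ) (1 / 2) ∧ x 3 ∈ Icc (0 : ℝ) 1}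

/-- Inverse polar coordinates on the thick shell: direction, sup-norm radius and height. -/
noncomputable def shellPoint (v : EuclideanSpace ℝ (Fin 3)) (p : EuclideanSpace ℝ (Fin 2)) :
    EuclideanSpace ℝ (Fin 4) :=
  !₂[1 / 2 + p 0 / ‖v.ofLp‖ * v 0, 1 / 2 + p 0 / ‖v.ofLp‖ * v 1,
    1 / 2 + p 0 / ‖v.ofLp‖ * v 2, p 1]

theorem centeredCoords_shellPoint (v : EuclideanSpace ℝ (Fin 3)) (p : EuclideanSpace ℝ (Fin 2)) :
    centeredCoords (shellPoint v p) = (p 0 / ‖v.ofLp‖) • v := by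
  ext i
  fin_cases i <;> simp [centeredCoords, shellPoint]

theorem shellPoint_smul_centeredCoords {x : EuclideanSpace ℝ (Fin 4)} {c : ℝ} (hc : 0 < c)
    (hx : 0 < ‖(centeredCoords x).ofLp‖) :
    shellPoint (c • centeredCoords x) !₂[‖(centeredCoords x).ofLp‖, x 3] = x := by
  have key : ‖(centeredCoords x).ofLp‖ / ‖(c • centeredCoords x).ofLp‖ * c = 1 := by
    rw [WithLp.ofLp_smul, norm_smul, Real.norm_of_nonneg hc.le]
    field_simp
  ext i
  fin_cases i <;> simp only [shellPoint, PiLp.smul_apply, smul_eq_mul, ← mul_assoc] <;>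
    simp [-WithLp.ofLp_smul, key] <;> simp [centeredCoords]

theorem ofLp_norm_pos {v : EuclideanSpace ℝ (Fin 3)} (hv : v ≠ 0) : 0 < ‖v.ofLp‖ := by
  simpa using hv

theorem ofLp_norm_centeredCoords_shellPoint {v : EuclideanSpace ℝ (Fin 3)} (hv : v ≠ 0)
    {p : EuclideanSpace ℝ (Fin 2)} (hp : 0 ≤ p 0) :
    ‖(centeredCoords (shellPoint v p)).ofLp‖ = p 0 := by
  have := ofLp_norm_pos hv
  rw [centeredCoords_shellPoint, WithLp.ofLp_smul, norm_smul, Real.norm_of_nonneg (by positivity)]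
  field_simp

/-- Polar coordinates on the thick shell. -/
noncomputable def thickShellHomeomorph :
    thickShell ≃ₜ sphere (0 : EuclideanSpace ℝ (Fin 3)) 1 ×
      euclideanBox ![(1 / 4 : ℝ), 0] ![1 / 2, 1] where
  toFun x :=
    (⟨‖centeredCoords x‖⁻¹ • centeredCoords x, by
      have h : centeredCoords x ≠ 0 := by
        intro h
        have := x.2.1.1
        norm_num [h] at this
      simp [norm_smul, h]⟩,
     ⟨!₂[‖(centeredCoords x).ofLp‖, x.1 3], by
      have := x.2
      simpa [euclideanBox, thickShell, Fin.forall_fin_two] using this⟩)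
  invFun q := ⟨shellPoint q.1 q.2, by
    have hq := q.2.2
    have hv : (q.1 : EuclideanSpace ℝ (Fin 3)) ≠ 0 := ne_zero_of_mem_unit_sphere q.1
    simp only [euclideanBox, Fin.forall_fin_two, mem_ofPred_eq] at hq
    have h0 : (1 / 4 : ℝ) ≤ q.2.1 0 := hq.1.1
    refine ⟨?_, by simpa [shellPoint] using hq.2⟩
    rw [ofLp_norm_centeredCoords_shellPoint hv (by linarith)]
    exact hq.1⟩
  left_inv x := by
    have hx : 0 < ‖(centeredCoords x).ofLp‖ := lt_of_lt_of_le (by norm_num) x.2.1.1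
    have h : centeredCoords x ≠ 0 := by
      intro h
      simp [h] at hx
    exact Subtype.ext (shellPoint_smul_centeredCoords (by positivity) hx)
  right_inv q := by
    have hq := q.2.2
    have hv : (q.1 : EuclideanSpace ℝ (Fin 3)) ≠ 0 := ne_zero_of_mem_unit_sphere q.1
    have hv' := ofLp_norm_pos hv
    have hn : ‖(q.1 : EuclideanSpace ℝ (Fin 3))‖ = 1 := by simp
    simp only [euclideanBox, Fin.forall_fin_two, mem_ofPred_eq] at hq
    have h0 : (1 / 4 : ℝ) ≤ q.2.1 0 := hq.1.1
    have h0' : 0 < q.2.1 0 := by linarith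
    refine Prod.ext (Subtype.ext ?_) (Subtype.ext ?_)
    · simp only [centeredCoords_shellPoint]
      rw [norm_smul, hn, mul_one, Real.norm_of_nonneg (by positivity), smul_smul,
        inv_mul_cancel₀ (by positivity), one_smul]
    · ext i
      fin_cases i
      · simpa using ofLp_norm_centeredCoords_shellPoint hv h0'.le
      · simp [shellPoint]
  continuous_toFun := by
    have hc : Continuous fun x : thickShell => centeredCoords x :=
      continuous_centeredCoords.comp continuous_subtype_val
    refine Continuous.prodMk (Continuous.subtype_mk ?_ _) (Continuous.subtype_mk ?_ _)
    · refine (hc.norm.inv₀ fun x h => ?_).smul hc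
      have := x.2.1.1
      norm_num [norm_eq_zero.1 h] at this
    · refine (PiLp.continuous_toLp 2 _).comp (continuous_pi fun i => ?_)
      fin_cases i
      · exact ((PiLp.continuous_ofLp 2 _).comp hc).norm
      · simp
        fun_prop
  continuous_invFun := by
    refine Continuous.subtype_mk ?_ _
    have hd : Continuous fun q : sphere (0 : EuclideanSpace ℝ (Fin 3)) 1 ×
        euclideanBox ![(1 / 4 : ℝ), 0] ![1 / 2, 1] => q.2.1 0 / ‖q.1.1.ofLp‖ := by
      refine Continuous.div (by fun_prop) (by fun_prop) fun q => ?_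
      exact (ofLp_norm_pos (ne_zero_of_mem_unit_sphere q.1)).ne'
    refine (PiLp.continuous_toLp 2 _).comp (continuous_pi fun i => ?_)
    fin_cases i <;> simp <;> fun_prop

theorem euclideanBox_subset_thickShell :
    euclideanBox ![0, 0, 0, 0] ![1 / 4, 1, 1, 1] ⊆ thickShell := by
  intro x hx
  simp [euclideanBox, Fin.forall_fin_succ] at hx
  obtain ⟨⟨h0, h0'⟩, ⟨h1, h1'⟩, ⟨h2, h2'⟩, h3⟩ := hx
  refine ⟨⟨?_, ?_⟩, h3⟩
  · by_contra! h
    have := (abs_lt.1 ((norm_centeredCoords_lt_iff (by norm_num)).1 h).1).1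
    linarith
  · rw [norm_centeredCoords_le_iff (by norm_num)]
    simp only [abs_le]
    refine ⟨⟨?_, ?_⟩, ⟨?_, ?_⟩, ?_, ?_⟩ <;> linarith

theorem disjoint_interior_euclideanBox_thickShell (s t : ℝ) :
    Disjoint (interior (euclideanBox ![1 / 4, 1 / 4, 1 / 4, s] ![3 / 4, 3 / 4, 3 / 4, t]))
      (interior thickShell) := by
  rw [interior_euclideanBox]
  refine disjoint_left.2 fun x hx hx' => (interior_subset hx').1.1.not_gt ?_
  simp [Fin.forall_fin_succ] at hx
  rw [norm_centeredCoords_lt_iff (by norm_num)]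
  simp only [abs_lt]
  refine ⟨⟨?_, ?_⟩, ⟨?_, ?_⟩, ?_, ?_⟩ <;> linarith

theorem disjoint_interior_euclideanBox_of_le {n : ℕ} {a b a' b' : Fin n → ℝ} (k : Fin n)
    (h : b k ≤ a' k) :
    Disjoint (interior (euclideanBox a b)) (interior (euclideanBox a' b')) := by
  simp only [interior_euclideanBox]
  exact disjoint_left.2 fun x hx hx' => ((hx k).2.trans_le h).not_gt (hx' k).1

theorem euclideanBox_union_thickShell :
    euclideanBox ![1 / 4, 1 / 4, 1 / 4, 0] ![3 / 4, 3 / 4, 3 / 4, 1 / 2] ∪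
      euclideanBox ![1 / 4, 1 / 4, 1 / 4, 1 / 2] ![3 / 4, 3 / 4, 3 / 4, 1] ∪ thickShell =
      {x : EuclideanSpace ℝ (Fin 4) | ∀ k, x k ∈ Icc (0 : ℝ) 1} := by
  ext x
  have hle := norm_centeredCoords_le_iff (x := x) (r := 1 / 4) (by norm_num)
  have hle' := norm_centeredCoords_le_iff (x := x) (r := 1 / 2) (by norm_num)
  simp only [abs_le] at hle hle'
  generalize hN : ‖(centeredCoords x).ofLp‖ = N at hle hle'
  simp only [mem_union, euclideanBox, thickShell, mem_ofPred_eq, hN, mem_Icc, Fin.forall_fin_succ]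
  simp
  generalize (x.ofLp 0 : ℝ) = a at *
  generalize (x.ofLp 1 : ℝ) = b at *
  generalize (x.ofLp 2 : ℝ) = c at *
  generalize (x.ofLp 3 : ℝ) = d at *
  beta_reduce at *
  clear hN
  grind (splits := 30)

/-- **Complement Covering Theorem for the hypercube (sphere case).** The unit hypercube
`[0,1]⁴ ⊆ ℝ⁴` is the union of three compact connected subsets with pairwise disjoint
nonempty interiors, two of which are homeomorphic to the closed unit 4-ball and the
third to `S² × D²`. -/
theorem hypercube4_three_piece_decomposition_sphere :
    ∃ T : Fin 3 → Set (EuclideanSpace ℝ (Fin 4)),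
      (⋃ i, T i) = {x : EuclideanSpace ℝ (Fin 4) | ∀ k, x k ∈ Set.Icc (0 : ℝ) 1} ∧
      (∀ i, IsCompact (T i)) ∧
      (∀ i, IsConnected (T i)) ∧
      (∀ i, (interior (T i)).Nonempty) ∧
      (∀ i j, i ≠ j → interior (T i) ∩ interior (T j) = ∅) ∧
      Nonempty ((T 0) ≃ₜ Metric.closedBall (0 : EuclideanSpace ℝ (Fin 4)) 1) ∧
      Nonempty ((T 1) ≃ₜ Metric.closedBall (0 : EuclideanSpace ℝ (Fin 4)) 1) ∧
      Nonempty ((T 2) ≃ₜ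
        (Metric.sphere (0 : EuclideanSpace ℝ (Fin 3)) 1 ×
          Metric.closedBall (0 : EuclideanSpace ℝ (Fin 2)) 1)) := by
  have hsphere : IsConnected (sphere (0 : EuclideanSpace ℝ (Fin 3)) 1) :=
    isConnected_sphere (by rw [← Module.finrank_eq_rank]; norm_num) 0 zero_le_one
  have hlower : ∀ k, (![1 / 4, 1 / 4, 1 / 4, 0] : Fin 4 → ℝ) k <
      (![3 / 4, 3 / 4, 3 / 4, 1 / 2] : Fin 4 → ℝ) k := by
    norm_num [Fin.forall_fin_succ]
  have hupper : ∀ k, (![1 / 4, 1 / 4, 1 / 4, 1 / 2] : Fin 4 → ℝ) k <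
      (![3 / 4, 3 / 4, 3 / 4, 1] : Fin 4 → ℝ) k := by
    norm_num [Fin.forall_fin_succ]
  have hslab : ∀ k, (![0, 0, 0, 0] : Fin 4 → ℝ) k < (![1 / 4, 1, 1, 1] : Fin 4 → ℝ) k := by
    norm_num [Fin.forall_fin_succ]
  have hrect : ∀ k, (![1 / 4, 0] : Fin 2 → ℝ) k < (![1 / 2, 1] : Fin 2 → ℝ) k := by
    norm_num [Fin.forall_fin_succ]
  have hcompact : IsCompact thickShell := by
    have := isCompact_iff_compactSpace.1 (isCompact_euclideanBox ![(1 / 4 : ℝ), 0] ![1 / 2, 1])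
    exact isCompact_iff_compactSpace.2 thickShellHomeomorph.symm.compactSpace
  have hconnected : IsConnected thickShell := by
    have := isConnected_iff_connectedSpace.1 hsphere
    have := isConnected_iff_connectedSpace.1 (isConnected_euclideanBox hrect)
    exact isConnected_iff_connectedSpace.2
      (thickShellHomeomorph.symm.surjective.connectedSpace thickShellHomeomorph.symm.continuous)
  have hboxes := disjoint_interior_euclideanBox_of_le (a := ![1 / 4, 1 / 4, 1 / 4, 0])
    (b := ![3 / 4, 3 / 4, 3 / 4, 1 / 2]) (a' := ![1 / 4, 1 / 4, 1 / 4, 1 / 2])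
    (b' := ![3 / 4, 3 / 4, 3 / 4, 1]) (3 : Fin 4) (by simp)
  have hlower_shell := disjoint_interior_euclideanBox_thickShell 0 (1 / 2)
  have hupper_shell := disjoint_interior_euclideanBox_thickShell (1 / 2) 1
  obtain ⟨e⟩ := nonempty_homeomorph_euclideanBox_closedBall hrect
  refine ⟨![euclideanBox ![1 / 4, 1 / 4, 1 / 4, 0] ![3 / 4, 3 / 4, 3 / 4, 1 / 2],
    euclideanBox ![1 / 4, 1 / 4, 1 / 4, 1 / 2] ![3 / 4, 3 / 4, 3 / 4, 1], thickShell],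
    ?_, ?_, ?_, ?_, ?_, nonempty_homeomorph_euclideanBox_closedBall hlower,
    nonempty_homeomorph_euclideanBox_closedBall hupper,
    ⟨thickShellHomeomorph.trans ((Homeomorph.refl _).prodCongr e)⟩⟩
  · rw [← euclideanBox_union_thickShell]
    ext x
    simp only [mem_iUnion, Fin.exists_fin_succ, mem_union]
    simp [or_assoc]
  · intro i
    fin_cases i
    exacts [isCompact_euclideanBox _ _, isCompact_euclideanBox _ _, hcompact]
  · intro i
    fin_cases i
    exacts [isConnected_euclideanBox hlower, isConnected_euclideanBox hupper, hconnected]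
  · intro i
    fin_cases i
    exacts [nonempty_interior_euclideanBox hlower, nonempty_interior_euclideanBox hupper,
      (nonempty_interior_euclideanBox hslab).mono (interior_mono euclideanBox_subset_thickShell)]
  · intro i j hij
    rw [← disjoint_iff_inter_eq_empty]
    fin_cases i <;> fin_cases j
    exacts [absurd rfl hij, hboxes, hlower_shell, hboxes.symm, absurd rfl hij, hupper_shell,
      hlower_shell.symm, hupper_shell.symm, absurd rfl hij]
end
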